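/- Let π be an irreducible cuspidal ψ-generic representation of the quasi-split non-split group SO_{2l} with normalized Bessel function B_{π,ψ}, let τ be an irreducible ψ^{−1}-generic representation of GL_l(F), and let v be a vector in the space of τ. Then Ψ(B_{π,ψ}, f_v) = W_v(w_{l,l}). Moreover, there exists v ∈ τ with Ψ(B_{π,ψ}, f_v) ≠ 0. -/

import Mathlib

open scoped MatrixGroups
open Matrix

noncomputable section

namespace ConverseSO

open Classical in
/-- Evaluate a function defined on `G` at a point of `M` through the (typically injective)
map `c : G → M`, extending by zero. -/
def matFun {G M R : Type*} [Zero R] (c : G → M) (φ : G → R) (m : M) : R :=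
  if h : ∃ g, c g = m then φ h.choose else 0

variable (F : Type) [Field F] [Fintype F]

/-- The antidiagonal matrix `J_m`. -/
def Jmat (m : ℕ) : Matrix (Fin m) (Fin m) F :=
  Matrix.of fun i j => if (i : ℕ) + (j : ℕ) + 1 = m then 1 else 0

/-- The middle-block modification `diag(I_{l-1}, [[0,1],[-ρ,0]], I_{l-1})`. -/
def Dmat (l : ℕ) (ρ : F) : Matrix (Fin (2*l)) (Fin (2*l)) F :=
  Matrix.of fun i j =>
    if (i : ℕ) = l - 1 ∧ (j : ℕ) = l then 1
    else if (i : ℕ) = l ∧ (j : ℕ) = l - 1 then -ρ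
    else if i = j ∧ (i : ℕ) ≠ l - 1 ∧ (i : ℕ) ≠ l then 1
    else 0

/-- `J_{2l,ρ}`. -/
def Jrho (l : ℕ) (ρ : F) : Matrix (Fin (2*l)) (Fin (2*l)) F := Dmat F l ρ * Jmat F (2*l)

/-- The matrix-level special orthogonal "set" attached to a matrix `Jm`. -/
def SOset (m : ℕ) (Jm : Matrix (Fin m) (Fin m) F) : Set (Matrix (Fin m) (Fin m) F) :=
  {g | g.det = 1 ∧ gᵀ * Jm * g = Jm}

/-- The special orthogonal group attached to a matrix `Jm`, as a subgroup of `GL`. -/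
def SOgrp (m : ℕ) (Jm : Matrix (Fin m) (Fin m) F) : Subgroup (GL (Fin m) F) where
  carrier := {g | ((g : Matrix (Fin m) (Fin m) F)).det = 1 ∧
    ((g : Matrix (Fin m) (Fin m) F))ᵀ * Jm * ((g : Matrix (Fin m) (Fin m) F)) = Jm}
  one_mem' := ⟨by simp, by simp⟩
  mul_mem' := by
    rintro a b ⟨ha1, ha2⟩ ⟨hb1, hb2⟩
    refine ⟨by rw [Units.val_mul, Matrix.det_mul, ha1, hb1, one_mul], ?_⟩
    have hab : ((a * b : GL (Fin m) F) : Matrix (Fin m) (Fin m) F)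
        = (a : Matrix (Fin m) (Fin m) F) * (b : Matrix (Fin m) (Fin m) F) := Units.val_mul a b
    rw [hab, Matrix.transpose_mul]
    calc (b : Matrix (Fin m) (Fin m) F)ᵀ * (a : Matrix (Fin m) (Fin m) F)ᵀ * Jm *
          ((a : Matrix (Fin m) (Fin m) F) * (b : Matrix (Fin m) (Fin m) F))
        = (b : Matrix (Fin m) (Fin m) F)ᵀ *
            ((a : Matrix (Fin m) (Fin m) F)ᵀ * Jm * (a : Matrix (Fin m) (Fin m) F)) *
            (b : Matrix (Fin m) (Fin m) F) := by
          simp only [mul_assoc]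
      _ = Jm := by rw [ha2, hb2]
  inv_mem' := by
    intro g hg
    obtain ⟨h1, h2⟩ := hg
    have hv1 : ((g⁻¹ : GL (Fin m) F) : Matrix (Fin m) (Fin m) F) * (g : Matrix (Fin m) (Fin m) F)
        = 1 := by rw [← Units.val_mul, inv_mul_cancel, Units.val_one]
    have hv2 : (g : Matrix (Fin m) (Fin m) F) * ((g⁻¹ : GL (Fin m) F) : Matrix (Fin m) (Fin m) F)
        = 1 := by rw [← Units.val_mul, mul_inv_cancel, Units.val_one]
    constructor
    · have hd := congrArg Matrix.det hv1
      rw [Matrix.det_mul, h1, mul_one, Matrix.det_one] at hd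
      exact hd
    · calc ((g⁻¹ : GL (Fin m) F) : Matrix (Fin m) (Fin m) F)ᵀ * Jm *
            ((g⁻¹ : GL (Fin m) F) : Matrix (Fin m) (Fin m) F)
          = ((g⁻¹ : GL (Fin m) F) : Matrix (Fin m) (Fin m) F)ᵀ *
              ((g : Matrix (Fin m) (Fin m) F)ᵀ * Jm * (g : Matrix (Fin m) (Fin m) F)) *
              ((g⁻¹ : GL (Fin m) F) : Matrix (Fin m) (Fin m) F) := by rw [h2]
        _ = ((g : Matrix (Fin m) (Fin m) F) *
              ((g⁻¹ : GL (Fin m) F) : Matrix (Fin m) (Fin m) F))ᵀ * Jm *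
              ((g : Matrix (Fin m) (Fin m) F) *
              ((g⁻¹ : GL (Fin m) F) : Matrix (Fin m) (Fin m) F)) := by
            rw [Matrix.transpose_mul]; simp only [mul_assoc]
        _ = Jm := by rw [hv2]; simp

/-- The quasi-split even special orthogonal group `SO_{2l}` attached to `J_{2l,ρ}`. -/
abbrev SO2l (l : ℕ) (ρ : F) : Subgroup (GL (Fin (2*l)) F) := SOgrp F (2*l) (Jrho F l ρ)

/-- The odd special orthogonal group `SO_{2m+1}` (split form). -/
abbrev SOodd (m : ℕ) : Subgroup (GL (Fin (2*m+1)) F) := SOgrp F (2*m+1) (Jmat F (2*m+1))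

/-- The underlying matrix of an element of a special orthogonal group. -/
def mat {m : ℕ} {Jm : Matrix (Fin m) (Fin m) F} (g : SOgrp F m Jm) :
    Matrix (Fin m) (Fin m) F :=
  ((g : GL (Fin m) F) : Matrix (Fin m) (Fin m) F)

/-- Upper triangular unipotent predicate for matrices. -/
def upUnip {m : ℕ} (M : Matrix (Fin m) (Fin m) F) : Prop :=
  ∀ i j : Fin m, (j : ℕ) ≤ (i : ℕ) → M i j = if i = j then 1 else 0

/-- The upper triangular unipotent subgroup (as a set) of `SO_{2l}`. -/
def USet (l : ℕ) (ρ : F) : Set (SO2l F l ρ) := {u | upUnip F (mat F u)}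

/-- The upper triangular unipotent matrices in `SO_{2m+1}` (matrix level). -/
def UoddMatSet (m : ℕ) : Set (Matrix (Fin (2*m+1)) (Fin (2*m+1)) F) :=
  {g | g ∈ SOset F (2*m+1) (Jmat F (2*m+1)) ∧ upUnip F g}

/-- The generic character of the upper unipotent subgroup of `SO_{2l}`:
`ψ(u_{1,2} + ⋯ + u_{l-2,l-1} + (1/2)·u_{l-1,l+1})` (1-indexed). -/
def psiU (l : ℕ) (ψ : AddChar F ℂ) (M : Matrix (Fin (2*l)) (Fin (2*l)) F) : ℂ :=
  ψ (∑ i : Fin (2*l), ∑ j : Fin (2*l),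
    (if (j : ℕ) = (i : ℕ) + 1 ∧ (i : ℕ) + 3 ≤ l then M i j
     else if (i : ℕ) + 2 = l ∧ (j : ℕ) = l then (2 : F)⁻¹ * M i j else 0))

/-- The sum `u_{1,2} + ⋯ + u_{n-1,n}` for an `n × n` matrix. -/
def glUSum (n : ℕ) (M : Matrix (Fin n) (Fin n) F) : F :=
  ∑ i : Fin n, ∑ j : Fin n, (if (j : ℕ) = (i : ℕ) + 1 then M i j else 0)

/-- The character `ψ_γ` of `N^{l-n}`:
`ψ(Σ_{i=1}^{l-n-1} v_{i,i+1} + (1/2)·v_{l-n-1,l+1})` (1-indexed). -/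
def psiGam (l n : ℕ) (ψ : AddChar F ℂ) (M : Matrix (Fin (2*l)) (Fin (2*l)) F) : ℂ :=
  ψ (∑ i : Fin (2*l), ∑ j : Fin (2*l),
    (if (j : ℕ) = (i : ℕ) + 1 ∧ (i : ℕ) + 2 + n ≤ l then M i j
     else if (i : ℕ) + 2 + n = l ∧ (j : ℕ) = l then (2 : F)⁻¹ * M i j else 0))

/-- Irreducibility of a representation. -/
def IsIrrep {G V : Type*} [Group G] [AddCommGroup V] [Module ℂ V]
    (π : Representation ℂ G V) : Prop :=
  (∃ v : V, v ≠ 0) ∧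
    ∀ W : Submodule ℂ V, (∀ g : G, ∀ v ∈ W, π g v ∈ W) → W = ⊥ ∨ W = ⊤

/-- Block index function determined by a set `C` of cuts (and their mirrors) for `SO_{2l}`. -/
def blkCut (l : ℕ) (C : Finset ℕ) (i : ℕ) : ℕ :=
  (C.filter (fun c => c ≤ i)).card + (C.filter (fun c => 2*l - c ≤ i)).card

/-- The unipotent radical of the standard parabolic subgroup of `SO_{2l}` given by cuts `C`. -/
def cuspUnip (l : ℕ) (ρ : F) (C : Finset ℕ) : Set (SO2l F l ρ) :=
  {g | ∀ i j : Fin (2*l), blkCut l C (j : ℕ) ≤ blkCut l C (i : ℕ) →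
    mat F g i j = if i = j then 1 else 0}

/-- Cuspidality: the full unipotent-radical sums vanish for every proper standard parabolic. -/
def IsCuspidal (l : ℕ) (ρ : F) {V : Type*} [AddCommGroup V] [Module ℂ V]
    (π : Representation ℂ (SO2l F l ρ) V) : Prop :=
  ∀ C : Finset ℕ, C.Nonempty → (∀ c ∈ C, 1 ≤ c ∧ c ≤ l - 1) →
    ∀ v : V, (∑ᶠ u ∈ cuspUnip F l ρ C, π u v) = 0

/-- `Γ` is a (nonzero) `ψ`-Whittaker functional for `π`. -/
def IsWhittaker (l : ℕ) (ρ : F) (ψ : AddChar F ℂ) {V : Type*} [AddCommGroup V] [Module ℂ V]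
    (π : Representation ℂ (SO2l F l ρ) V) (Γ : V →ₗ[ℂ] ℂ) : Prop :=
  Γ ≠ 0 ∧ ∀ u ∈ USet F l ρ, ∀ v : V, Γ (π u v) = psiU F l ψ (mat F u) * Γ v

/-- `v₀` is a Whittaker vector with `Γ v₀ ≠ 0`. -/
def IsWhitVec (l : ℕ) (ρ : F) (ψ : AddChar F ℂ) {V : Type*} [AddCommGroup V] [Module ℂ V]
    (π : Representation ℂ (SO2l F l ρ) V) (Γ : V →ₗ[ℂ] ℂ) (v₀ : V) : Prop :=
  Γ v₀ ≠ 0 ∧ ∀ u ∈ USet F l ρ, π u v₀ = psiU F l ψ (mat F u) • v₀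

/-- The normalized Bessel function attached to the Whittaker data `(Γ, v₀)`. -/
def Bessel (l : ℕ) (ρ : F) {V : Type*} [AddCommGroup V] [Module ℂ V]
    (π : Representation ℂ (SO2l F l ρ) V) (Γ : V →ₗ[ℂ] ℂ) (v₀ : V) :
    SO2l F l ρ → ℂ :=
  fun g => Γ (π g v₀) / Γ v₀

/-- Equality of central characters. -/
def SameCentralChar (l : ℕ) (ρ : F) {V V' : Type*} [AddCommGroup V] [Module ℂ V]
    [AddCommGroup V'] [Module ℂ V'] (π : Representation ℂ (SO2l F l ρ) V)
    (π' : Representation ℂ (SO2l F l ρ) V') : Prop :=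
  ∃ ω : ℂ, (∀ g : SO2l F l ρ, mat F g = -1 → ∀ v : V, π g v = ω • v) ∧
    (∀ g : SO2l F l ρ, mat F g = -1 → ∀ v' : V', π' g v' = ω • v')
/-- `a^* = J_n · (a⁻¹)ᵀ · J_n`. -/
def aStar (n : ℕ) (a : Matrix (Fin n) (Fin n) F) : Matrix (Fin n) (Fin n) F :=
  Jmat F n * (a⁻¹)ᵀ * Jmat F n

/-- The permutation matrix of `σ`. -/
def permMat (n : ℕ) (σ : Equiv.Perm (Fin n)) : Matrix (Fin n) (Fin n) F :=
  Matrix.of fun i j => if σ j = i then 1 else 0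

/-- `t_n(a) = diag(a, I_{2l-2n}, a^*)` inside `2l × 2l` matrices. -/
def tnMat (l n : ℕ) (a : Matrix (Fin n) (Fin n) F) : Matrix (Fin (2*l)) (Fin (2*l)) F :=
  Matrix.of fun i j =>
    if hi : (i : ℕ) < n then (if hj : (j : ℕ) < n then a ⟨i, hi⟩ ⟨j, hj⟩ else 0)
    else if hi2 : (i : ℕ) < 2*l - n then (if i = j then 1 else 0)
    else if hj2 : 2*l - n ≤ (j : ℕ) then
      aStar F n a ⟨(i : ℕ) - (2*l - n), by have := i.isLt; omega⟩
        ⟨(j : ℕ) - (2*l - n), by have := j.isLt; omega⟩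
    else 0

/-- The Weyl representative `w̃_n` of `SO_{2l}` as a block matrix. -/
def wTildeMat (l n : ℕ) : Matrix (Fin (2*l)) (Fin (2*l)) F :=
  Matrix.of fun i j =>
    if (i : ℕ) < n then (if (j : ℕ) = (i : ℕ) + (2*l - n) then 1 else 0)
    else if (i : ℕ) < l - 1 then (if i = j then 1 else 0)
    else if (i : ℕ) = l - 1 then (if i = j then (-1)^n else 0)
    else if (i : ℕ) < 2*l - n then (if i = j then 1 else 0)
    else (if (j : ℕ) + (2*l - n) = (i : ℕ) then 1 else 0)

/-- The torus matrix `diag(t_1,…,t_{l-1}, [[a,bρ],[b,a]], t_{l-1}⁻¹,…,t_1⁻¹)`. -/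
def torusMat (l : ℕ) (ρ : F) (tv : ℕ → Fˣ) (a b : F) :
    Matrix (Fin (2*l)) (Fin (2*l)) F :=
  Matrix.of fun i j =>
    if (i : ℕ) < l - 1 then (if i = j then (tv (i : ℕ) : F) else 0)
    else if (i : ℕ) = l - 1 then
      (if (j : ℕ) = l - 1 then a else if (j : ℕ) = l then b * ρ else 0)
    else if (i : ℕ) = l then
      (if (j : ℕ) = l - 1 then b else if (j : ℕ) = l then a else 0)
    else (if i = j then ((tv (2*l - 1 - (i : ℕ)))⁻¹ : F) else 0)

/-- The outer element `c = diag(I_{l-1}, 1, -1, I_{l-1})`. -/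
def cMat (l : ℕ) : Matrix (Fin (2*l)) (Fin (2*l)) F :=
  Matrix.of fun i j => if i = j then (if (i : ℕ) = l then -1 else 1) else 0

/-- The torus element `t̃ = diag(I_{l-1}, -1, -1, I_{l-1})`. -/
def tTildeMat (l : ℕ) : Matrix (Fin (2*l)) (Fin (2*l)) F :=
  Matrix.of fun i j =>
    if i = j then (if (i : ℕ) = l - 1 ∨ (i : ℕ) = l then -1 else 1) else 0

/-- `l_n(a) = diag(a, 1, a^*)` inside `(2n+1) × (2n+1)` matrices. -/
def lnMat (n : ℕ) (a : Matrix (Fin n) (Fin n) F) :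
    Matrix (Fin (2*n+1)) (Fin (2*n+1)) F :=
  Matrix.of fun i j =>
    if hi : (i : ℕ) < n then (if hj : (j : ℕ) < n then a ⟨i, hi⟩ ⟨j, hj⟩ else 0)
    else if hi2 : (i : ℕ) = n then (if i = j then 1 else 0)
    else if hj2 : n + 1 ≤ (j : ℕ) then
      aStar F n a ⟨(i : ℕ) - (n+1), by have := i.isLt; omega⟩
        ⟨(j : ℕ) - (n+1), by have := j.isLt; omega⟩
    else 0

/-- The Weyl element `w_n` of `SO_{2n+1}` with block rows `(0,0,I_n)`, `(0,(-1)^n,0)`, `(I_n,0,0)`. -/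
def wnOddMat (n : ℕ) : Matrix (Fin (2*n+1)) (Fin (2*n+1)) F :=
  Matrix.of fun i j =>
    if (i : ℕ) < n then (if (j : ℕ) = (i : ℕ) + n + 1 then 1 else 0)
    else if (i : ℕ) = n then (if i = j then (-1)^n else 0)
    else (if (j : ℕ) + n + 1 = (i : ℕ) then 1 else 0)

/-- `d_n = diag(-1, 1, …, (-1)^n)`. -/
def dnMat (n : ℕ) : Matrix (Fin n) (Fin n) F :=
  Matrix.of fun i j => if i = j then (-1)^((i : ℕ) + 1) else 0

/-- The block permutation matrix `w^{l,n}` of `SO_{2l}`. -/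
def wlnMat (l n : ℕ) : Matrix (Fin (2*l)) (Fin (2*l)) F :=
  Matrix.of fun i j =>
    if (i : ℕ) < n then (if (j : ℕ) = (i : ℕ) + (l - n - 1) then 1 else 0)
    else if (i : ℕ) < l - 1 then (if (j : ℕ) + n = (i : ℕ) then 1 else 0)
    else if (i : ℕ) < l + 1 then (if i = j then 1 else 0)
    else if (i : ℕ) < 2*l - n then (if (j : ℕ) = (i : ℕ) + n then 1 else 0)
    else (if (j : ℕ) + (l - n - 1) = (i : ℕ) then 1 else 0)

/-- `w_{l,l} = diag(γ·I_l, 1, γ⁻¹·I_l)` with `γ = ρ/2`. -/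
def wllMat (l : ℕ) (ρ : F) : Matrix (Fin (2*l+1)) (Fin (2*l+1)) F :=
  Matrix.of fun i j =>
    if i = j then
      (if (i : ℕ) < l then ρ/2 else if (i : ℕ) = l then 1 else (ρ/2)⁻¹)
    else 0

/-- The conjugating matrix `M` for the embedding of `SO_{2l}` into `SO_{2l+1}`. -/
def Mtop (l : ℕ) (ρ : F) : Matrix (Fin (2*l+1)) (Fin (2*l+1)) F :=
  Matrix.of fun i j =>
    if (i : ℕ) + 2 = l + 1 then (if (j : ℕ) = l then 1 else 0)
    else if (i : ℕ) = l then
      (if (j : ℕ) + 2 = l + 1 then (2 : F)⁻¹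
       else if (j : ℕ) = l + 1 then (2 * (ρ/2))⁻¹ else 0)
    else if (i : ℕ) = l + 1 then
      (if (j : ℕ) + 2 = l + 1 then (2 : F)⁻¹
       else if (j : ℕ) = l + 1 then -(2 * (ρ/2))⁻¹ else 0)
    else if i = j then 1 else 0

/-- Insert a trivial `(l+1)`-st row and column (1-indexed) into a `2l × 2l` matrix. -/
def insTop (l : ℕ) (g : Matrix (Fin (2*l)) (Fin (2*l)) F) :
    Matrix (Fin (2*l+1)) (Fin (2*l+1)) F :=
  Matrix.of fun i j =>
    if hi : (i : ℕ) = l then (if (j : ℕ) = l then 1 else 0)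
    else if hj : (j : ℕ) = l then 0
    else
      g ⟨if (i : ℕ) < l then (i : ℕ) else (i : ℕ) - 1, by have := i.isLt; split <;> omega⟩
        ⟨if (j : ℕ) < l then (j : ℕ) else (j : ℕ) - 1, by have := j.isLt; split <;> omega⟩

/-- The embedding of `SO_{2l}` into `SO_{2l+1}` at the matrix level. -/
def embTop (l : ℕ) (ρ : F) (g : Matrix (Fin (2*l)) (Fin (2*l)) F) :
    Matrix (Fin (2*l+1)) (Fin (2*l+1)) F :=
  (Mtop F l ρ)⁻¹ * insTop F l g * Mtop F l ρ

/-- The conjugating matrix `M = diag(I_n, [[0,2],[1,0]], I_n)` (size `2n+2`). -/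
def Mlow (n : ℕ) : Matrix (Fin (2*n+2)) (Fin (2*n+2)) F :=
  Matrix.of fun i j =>
    if (i : ℕ) = n then (if (j : ℕ) = n + 1 then 2 else 0)
    else if (i : ℕ) = n + 1 then (if (j : ℕ) = n then 1 else 0)
    else if i = j then 1 else 0

/-- Insert a trivial `(n+2)`-nd row and column (1-indexed) into a `(2n+1) × (2n+1)` matrix. -/
def insLow (n : ℕ) (g : Matrix (Fin (2*n+1)) (Fin (2*n+1)) F) :
    Matrix (Fin (2*n+2)) (Fin (2*n+2)) F :=
  Matrix.of fun i j =>
    if hi : (i : ℕ) = n + 1 then (if (j : ℕ) = n + 1 then 1 else 0)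
    else if hj : (j : ℕ) = n + 1 then 0
    else
      g ⟨if (i : ℕ) < n + 1 then (i : ℕ) else (i : ℕ) - 1, by have := i.isLt; split <;> omega⟩
        ⟨if (j : ℕ) < n + 1 then (j : ℕ) else (j : ℕ) - 1, by have := j.isLt; split <;> omega⟩

/-- The middle `2n+2` block of the embedding of `SO_{2n+1}` into `SO_{2l}`. -/
def embLowMid (n : ℕ) (g : Matrix (Fin (2*n+1)) (Fin (2*n+1)) F) :
    Matrix (Fin (2*n+2)) (Fin (2*n+2)) F :=
  (Mlow F n)⁻¹ * insLow F n g * Mlow F n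

/-- The embedding of `SO_{2n+1}` into `SO_{2l}` (for `n < l`) at the matrix level. -/
def embLow (l n : ℕ) (g : Matrix (Fin (2*n+1)) (Fin (2*n+1)) F) :
    Matrix (Fin (2*l)) (Fin (2*l)) F :=
  Matrix.of fun i j =>
    if h : l - n - 1 ≤ (i : ℕ) ∧ (i : ℕ) < l + n + 1 ∧ l - n - 1 ≤ (j : ℕ) ∧ (j : ℕ) < l + n + 1
    then embLowMid F n g ⟨(i : ℕ) - (l - n - 1), by omega⟩ ⟨(j : ℕ) - (l - n - 1), by omega⟩
    else if i = j then 1 else 0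
/-- The maximal torus `T` of `SO_{2l}`. -/
def TSet (l : ℕ) (ρ : F) : Set (SO2l F l ρ) :=
  {g | ∃ (tv : ℕ → Fˣ) (a b : F), a^2 - b^2 * ρ = 1 ∧ mat F g = torusMat F l ρ tv a b}

/-- The split subtorus `S` of `T`. -/
def SSet (l : ℕ) (ρ : F) : Set (SO2l F l ρ) :=
  {g | ∃ tv : ℕ → Fˣ, mat F g = torusMat F l ρ tv 1 0}

/-- The standard Borel subgroup `B = T·U` of `SO_{2l}` (as a set). -/
def BorelSet (l : ℕ) (ρ : F) : Set (SO2l F l ρ) :=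
  {b | ∃ t ∈ TSet F l ρ, ∃ u ∈ USet F l ρ, b = t * u}

/-- `w` normalizes the torus `T`. -/
def NormalizesT (l : ℕ) (ρ : F) (w : SO2l F l ρ) : Prop :=
  ∀ t ∈ TSet F l ρ, w * t * w⁻¹ ∈ TSet F l ρ ∧ w⁻¹ * t * w ∈ TSet F l ρ

/-- Standard basis weight `e_k` (as an integral character vector). -/
def eVec (k : ℕ) : ℕ → ℤ := fun i => if i = k then 1 else 0

/-- The simple (restricted) roots of `SO_{2l}`: `α_k = e_k - e_{k+1}` for `k < l-2`
(0-indexed) and `α_{l-2} = e_{l-2}`. -/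
def simpleRoot (l k : ℕ) : ℕ → ℤ :=
  fun i => (if i = k then 1 else 0) - (if i = k + 1 ∧ k + 3 ≤ l then 1 else 0)

/-- The positive (restricted) roots of `SO_{2l}` (type `B_{l-1}`). -/
def posRoot (l : ℕ) : Set (ℕ → ℤ) :=
  {α | (∃ i j, i < j ∧ j < l - 1 ∧ α = fun k => eVec i k - eVec j k) ∨
       (∃ i j, i < j ∧ j < l - 1 ∧ α = fun k => eVec i k + eVec j k) ∨
       (∃ i, i < l - 1 ∧ α = eVec i)}

/-- Negative roots. -/
def negRoot (l : ℕ) : Set (ℕ → ℤ) := {α | (fun k => -(α k)) ∈ posRoot l}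

/-- Simple roots (as a set). -/
def isSimpleRoot (l : ℕ) (α : ℕ → ℤ) : Prop := ∃ k, k < l - 1 ∧ α = simpleRoot l k

/-- Evaluation of an integral character vector on an element of the split torus. -/
def rootEval (l : ℕ) (ρ : F) (α : ℕ → ℤ) (g : SO2l F l ρ) : F :=
  ∏ i : Fin (2*l), (if (i : ℕ) < l - 1 then (mat F g i i) ^ (α (i : ℕ)) else 1)

/-- The Weyl representative `w` maps the character `α` of `S` to the character `β`. -/
def mapsRoot (l : ℕ) (ρ : F) (w : SO2l F l ρ) (α β : ℕ → ℤ) : Prop :=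
  ∀ s ∈ SSet F l ρ, w⁻¹ * s * w ∈ SSet F l ρ ∧
    rootEval F l ρ β s = rootEval F l ρ α (w⁻¹ * s * w)

/-- The Weyl representative `w` supports Bessel functions: every simple root is mapped
to a negative or simple root. -/
def SupportsBessel (l : ℕ) (ρ : F) (w : SO2l F l ρ) : Prop :=
  ∀ k, k < l - 1 → ∃ β : ℕ → ℤ, mapsRoot F l ρ w (simpleRoot l k) β ∧
    (β ∈ negRoot l ∨ isSimpleRoot l β)

/-- `θ_w = {k : wα_k is positive}`. -/
def besselTheta (l : ℕ) (ρ : F) (w : SO2l F l ρ) : Set ℕ :=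
  {k | k < l - 1 ∧ ∃ β : ℕ → ℤ, mapsRoot F l ρ w (simpleRoot l k) β ∧ β ∈ posRoot l}

/-- The cell `B_n(SO_{2l}) = {t_n(w')·w̃_n : w' ∈ W(GL_n)}`. -/
def BnSet (l : ℕ) (ρ : F) (n : ℕ) : Set (SO2l F l ρ) :=
  {g | ∃ σ : Equiv.Perm (Fin n), mat F g = tnMat F l n (permMat F n σ) * wTildeMat F l n}

/-- Block index for the Siegel parabolic of `SO_{2n+1}`. -/
def blkSiegel (n i : ℕ) : ℕ := if i < n then 0 else if i = n then 1 else 2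

/-- The unipotent radical `V_n` of the Siegel parabolic of `SO_{2n+1}` (matrix level). -/
def VnSet (n : ℕ) : Set (Matrix (Fin (2*n+1)) (Fin (2*n+1)) F) :=
  {m | m ∈ SOset F (2*n+1) (Jmat F (2*n+1)) ∧
    ∀ i j : Fin (2*n+1), blkSiegel n (j : ℕ) ≤ blkSiegel n (i : ℕ) →
      m i j = if i = j then 1 else 0}

/-- The group `R^{l,n}` (matrix level). -/
def RlnSet (l : ℕ) (ρ : F) (n : ℕ) : Set (Matrix (Fin (2*l)) (Fin (2*l)) F) :=
  {m | m ∈ SOset F (2*l) (Jrho F l ρ) ∧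
    ∀ i j : Fin (2*l),
      ¬((n ≤ (i : ℕ) ∧ (i : ℕ) < l - 1 ∧ (j : ℕ) < n) ∨
        (2*l - n ≤ (i : ℕ) ∧ l + 1 ≤ (j : ℕ) ∧ (j : ℕ) < 2*l - n)) →
      m i j = if i = j then 1 else 0}

/-- The subgroup `N^{l-n} = U_{GL_{l-n-1}}·N_{l-n-1}` of `SO_{2l}`. -/
def NlnSet (l : ℕ) (ρ : F) (n : ℕ) : Set (SO2l F l ρ) :=
  {g | upUnip F (mat F g) ∧
    ∀ i j : Fin (2*l), l - n - 1 ≤ (i : ℕ) → (i : ℕ) < l + n + 1 →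
      l - n - 1 ≤ (j : ℕ) → (j : ℕ) < l + n + 1 →
      mat F g i j = if i = j then 1 else 0}

/-- Block index for standard parabolic subgroups of `SO_{2m+1}`, given cuts `C`. -/
def blkB (m : ℕ) (C : Finset ℕ) (i : ℕ) : ℕ :=
  (C.filter (fun c => c ≤ i)).card + (C.filter (fun c => 2*m + 1 - c ≤ i)).card

/-- The standard parabolic subgroup of `SO_{2m+1}` given by cuts `C` (as a set). -/
def pbP (m : ℕ) (C : Finset ℕ) : Set (SOodd F m) :=
  {g | ∀ i j : Fin (2*m+1), blkB m C (j : ℕ) < blkB m C (i : ℕ) → mat F g i j = 0}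

/-- The unipotent radical of the standard parabolic subgroup of `SO_{2m+1}` given by cuts `C`. -/
def pbV (m : ℕ) (C : Finset ℕ) : Set (SOodd F m) :=
  {g | ∀ i j : Fin (2*m+1), blkB m C (j : ℕ) ≤ blkB m C (i : ℕ) →
    mat F g i j = if i = j then 1 else 0}
/-- Apply a representation of `GL_n(F)` at a plain matrix (zero if not invertible). -/
def tauApp (n : ℕ) {Wτ : Type*} [AddCommGroup Wτ] [Module ℂ Wτ]
    (τ : Representation ℂ (GL (Fin n) F) Wτ) (m : Matrix (Fin n) (Fin n) F) :
    Wτ →ₗ[ℂ] Wτ :=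
  matFun (fun g : GL (Fin n) F => (g : Matrix (Fin n) (Fin n) F)) (fun g => τ g) m

/-- `Λ` is a nonzero `ψ⁻¹`-Whittaker functional for the representation `τ` of `GL_n(F)`. -/
def IsGenericGLinv (n : ℕ) (ψ : AddChar F ℂ) {Wτ : Type*} [AddCommGroup Wτ] [Module ℂ Wτ]
    (τ : Representation ℂ (GL (Fin n) F) Wτ) (Λ : Wτ →ₗ[ℂ] ℂ) : Prop :=
  Λ ≠ 0 ∧ ∀ u : GL (Fin n) F, upUnip F ((u : Matrix (Fin n) (Fin n) F)) →
    ∀ x : Wτ, Λ (τ u x) = ψ (-(glUSum F n (u : Matrix (Fin n) (Fin n) F))) * Λ x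

/-- The induced space `I(τ) = Ind_{Q_n}^{SO_{2n+1}} τ` (matrix level). -/
def IndTau (n : ℕ) {Wτ : Type*} [AddCommGroup Wτ] [Module ℂ Wτ]
    (τ : Representation ℂ (GL (Fin n) F) Wτ) :
    Set (Matrix (Fin (2*n+1)) (Fin (2*n+1)) F → Wτ) :=
  {ξ | (∀ g, g ∉ SOset F (2*n+1) (Jmat F (2*n+1)) → ξ g = 0) ∧
    ∀ a : GL (Fin n) F, ∀ u ∈ VnSet F n, ∀ g,
      ξ (lnMat F n (a : Matrix (Fin n) (Fin n) F) * u * g) = τ a (ξ g)}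

/-- The space `I(τ, ψ⁻¹)` spanned by the functions `f_ξ(g,a) = Λ(τ(a)ξ(g))`. -/
def Imodel (n : ℕ) {Wτ : Type*} [AddCommGroup Wτ] [Module ℂ Wτ]
    (τ : Representation ℂ (GL (Fin n) F) Wτ) (Λ : Wτ →ₗ[ℂ] ℂ) :
    Set (Matrix (Fin (2*n+1)) (Fin (2*n+1)) F → Matrix (Fin n) (Fin n) F → ℂ) :=
  {f | ∃ ξ ∈ IndTau F n τ, f = fun g a => Λ (tauApp F n τ a (ξ g))}

open Classical in
/-- The section `ξ_v ∈ I(τ)` supported on the Siegel parabolic with `ξ_v(l_n(a)u) = τ(a)v`. -/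
def xiv (n : ℕ) {Wτ : Type*} [AddCommGroup Wτ] [Module ℂ Wτ]
    (τ : Representation ℂ (GL (Fin n) F) Wτ) (v : Wτ) :
    Matrix (Fin (2*n+1)) (Fin (2*n+1)) F → Wτ :=
  fun m =>
    if h : ∃ p : (GL (Fin n) F) × Matrix (Fin (2*n+1)) (Fin (2*n+1)) F,
        p.2 ∈ VnSet F n ∧ m = lnMat F n ((p.1 : Matrix (Fin n) (Fin n) F)) * p.2
    then τ h.choose.1 v else 0

/-- The function `f_v = f_{ξ_v} ∈ I(τ, ψ⁻¹)`. -/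
def fvFun (n : ℕ) {Wτ : Type*} [AddCommGroup Wτ] [Module ℂ Wτ]
    (τ : Representation ℂ (GL (Fin n) F) Wτ) (Λ : Wτ →ₗ[ℂ] ℂ) (v : Wτ) :
    Matrix (Fin (2*n+1)) (Fin (2*n+1)) F → Matrix (Fin n) (Fin n) F → ℂ :=
  fun g a => Λ (tauApp F n τ a (xiv F n τ v g))

/-- The intertwining operator `M(τ, ψ⁻¹)` at the level of functions. -/
def MOp (n : ℕ)
    (f : Matrix (Fin (2*n+1)) (Fin (2*n+1)) F → Matrix (Fin n) (Fin n) F → ℂ) :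
    Matrix (Fin (2*n+1)) (Fin (2*n+1)) F → Matrix (Fin n) (Fin n) F → ℂ :=
  fun h a => ∑ᶠ u ∈ VnSet F n, f (wnOddMat F n * u * h) (dnMat F n * aStar F n a)

/-- The zeta integral for `n < l`, via the embedding `SO_{2n+1} → SO_{2l}`
(the sum over coset representatives is realized as `|U|⁻¹` times the full sum). -/
def ZetaLow (l : ℕ) (ρ : F) (n : ℕ) (φ : SO2l F l ρ → ℂ)
    (f : Matrix (Fin (2*n+1)) (Fin (2*n+1)) F → Matrix (Fin n) (Fin n) F → ℂ) : ℂ :=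
  (Nat.card (UoddMatSet F n) : ℂ)⁻¹ *
    ∑ᶠ g ∈ SOset F (2*n+1) (Jmat F (2*n+1)),
      (∑ᶠ r ∈ RlnSet F l ρ n,
        matFun (fun x : SO2l F l ρ => mat F x) φ
          (r * wlnMat F l n * embLow F l n g * (wlnMat F l n)⁻¹)) * f g 1

/-- The zeta integral for `n = l`, via the embedding `SO_{2l} → SO_{2l+1}`. -/
def ZetaTop (l : ℕ) (ρ : F) (φ : SO2l F l ρ → ℂ)
    (f : Matrix (Fin (2*l+1)) (Fin (2*l+1)) F → Matrix (Fin l) (Fin l) F → ℂ) : ℂ :=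
  (Nat.card (USet F l ρ) : ℂ)⁻¹ *
    ∑ᶠ g : SO2l F l ρ, φ g * f (wllMat F l ρ * embTop F l ρ (mat F g)) 1

/-- The combined zeta integral `Ψ` for `1 ≤ n ≤ l`. -/
def Zeta (l : ℕ) (ρ : F) (n : ℕ) (φ : SO2l F l ρ → ℂ)
    (f : Matrix (Fin (2*n+1)) (Fin (2*n+1)) F → Matrix (Fin n) (Fin n) F → ℂ) : ℂ :=
  if n < l then ZetaLow F l ρ n φ f
  else if h : n = l then ZetaTop F l ρ φ (cast (by rw [h]) f)
  else 0

/-- `c` is the gamma factor `γ(π × τ, ψ)`: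
`c · Ψ(W_v, f) = Ψ(W_v, M(τ,ψ⁻¹) f)` for all Whittaker functions `W_v` of `π`
and all `f ∈ I(τ, ψ⁻¹)`. -/
def IsGamma (l : ℕ) (ρ : F) (n : ℕ) {V : Type*} [AddCommGroup V] [Module ℂ V]
    (π : Representation ℂ (SO2l F l ρ) V) (Γ : V →ₗ[ℂ] ℂ)
    {Wτ : Type*} [AddCommGroup Wτ] [Module ℂ Wτ]
    (τ : Representation ℂ (GL (Fin n) F) Wτ) (Λ : Wτ →ₗ[ℂ] ℂ) (c : ℂ) : Prop :=
  ∀ v : V, ∀ f ∈ Imodel F n τ Λ,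
    c * Zeta F l ρ n (fun g => Γ (π g v)) f =
      Zeta F l ρ n (fun g => Γ (π g v)) (MOp F n f)

/-- The Bessel function of the conjugate representation `π^c`:
`B_{π^c,ψ}(g) = B_{π,ψ}(c·t̃⁻¹·g·t̃·c)`. -/
def BesselConj (l : ℕ) (ρ : F) (B : SO2l F l ρ → ℂ) : SO2l F l ρ → ℂ :=
  fun g => matFun (fun x : SO2l F l ρ => mat F x) B
    (cMat F l * (tTildeMat F l)⁻¹ * mat F g * tTildeMat F l * cMat F l)

section Preparations

set_option linter.unusedSectionVars false

variable {F}

/-! ### The symmetric forms -/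

lemma Jmat_apply {m : ℕ} (i j : Fin m) : Jmat F m i j = if j = Fin.rev i then 1 else 0 := by
  simp only [Jmat, Matrix.of_apply, Fin.ext_iff, Fin.val_rev]
  congr 1
  apply propext
  omega

lemma Jmat_mul_apply {m : ℕ} {o : Type*} (X : Matrix (Fin m) o F) (i : Fin m) (j : o) :
    (Jmat F m * X) i j = X (Fin.rev i) j := by
  simp [Matrix.mul_apply, Jmat_apply]

lemma mul_Jmat_apply {m : ℕ} {o : Type*} (X : Matrix o (Fin m) F) (i : o) (j : Fin m) :
    (X * Jmat F m) i j = X i (Fin.rev j) := by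
  have h : ∀ k : Fin m, (j = Fin.rev k) = (k = Fin.rev j) := fun k =>
    propext (by rw [Fin.ext_iff, Fin.ext_iff, Fin.val_rev, Fin.val_rev]; omega)
  simp [Matrix.mul_apply, Jmat_apply, h]

lemma Jmat_mul_self (m : ℕ) : Jmat F m * Jmat F m = 1 := by
  ext i j
  rw [Jmat_mul_apply, Jmat_apply, Fin.rev_rev, Matrix.one_apply]
  simp [eq_comm]

lemma Jrho_apply {l : ℕ} (hl : 2 ≤ l) (ρ : F) (i j : Fin (2*l)) :
    Jrho F l ρ i j =
      if (i : ℕ) = l - 1 then (if j = i then 1 else 0)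
      else if (i : ℕ) = l then (if j = i then -ρ else 0)
      else (if j = Fin.rev i then 1 else 0) := by
  have := i.isLt
  have := j.isLt
  simp only [Jrho, mul_Jmat_apply, Dmat, Matrix.of_apply, Fin.ext_iff, Fin.val_rev]
  split_ifs <;> first | rfl | omega

lemma Jrho_transpose {l : ℕ} (hl : 2 ≤ l) (ρ : F) : (Jrho F l ρ)ᵀ = Jrho F l ρ := by
  ext i j
  have := i.isLt
  have := j.isLt
  simp only [Matrix.transpose_apply, Jrho_apply hl, Fin.ext_iff, Fin.val_rev]
  split_ifs <;> first | rfl | omega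

lemma Jrho_mulVec {l : ℕ} (hl : 2 ≤ l) (ρ : F) (x : Fin (2*l) → F) (i : Fin (2*l)) :
    (Jrho F l ρ *ᵥ x) i =
      if (i : ℕ) = l - 1 then x i else if (i : ℕ) = l then -ρ * x i else x (Fin.rev i) := by
  simp only [Matrix.mulVec, dotProduct, Jrho_apply hl]
  split_ifs <;> simp

/-! ### Eichler transformations -/

/-- The Eichler transformation `v ↦ v + B(z,v) x - B(x,v) z - ½ B(z,z) B(x,v) x` of the bilinear
form `B` with Gram matrix `J`. -/
def eichler {m : ℕ} (J : Matrix (Fin m) (Fin m) F) (x z : Fin m → F) :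
    Matrix (Fin m) (Fin m) F :=
  1 + vecMulVec x (J *ᵥ z) - vecMulVec z (J *ᵥ x)
    - (2⁻¹ * (z ⬝ᵥ J *ᵥ z)) • vecMulVec x (J *ᵥ x)

lemma eichler_form {m : ℕ} {J : Matrix (Fin m) (Fin m) F} (h2 : (2 : F) ≠ 0) (hJ : Jᵀ = J)
    {x z : Fin m → F} (hxx : x ⬝ᵥ J *ᵥ x = 0) (hxz : x ⬝ᵥ J *ᵥ z = 0) :
    (eichler J x z)ᵀ * J * eichler J x z = J := by
  have hv : ∀ y, y ᵥ* J = J *ᵥ y := fun y => by rw [← Matrix.mulVec_transpose, hJ]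
  have hzx : z ⬝ᵥ J *ᵥ x = 0 := by
    rw [Matrix.dotProduct_mulVec, hv, dotProduct_comm, hxz]
  have hxx' : (J *ᵥ x) ⬝ᵥ x = 0 := by rw [dotProduct_comm, hxx]
  have hzx' : (J *ᵥ x) ⬝ᵥ z = 0 := by rw [dotProduct_comm, hzx]
  have hxz' : (J *ᵥ z) ⬝ᵥ x = 0 := by rw [dotProduct_comm, hxz]
  have hzz' : (J *ᵥ z) ⬝ᵥ z = z ⬝ᵥ J *ᵥ z := by rw [dotProduct_comm]
  set t := z ⬝ᵥ J *ᵥ z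
  have e1 : (eichler J x z)ᵀ * J = J + vecMulVec (J *ᵥ z) (J *ᵥ x)
      - vecMulVec (J *ᵥ x) (J *ᵥ z) - (2⁻¹ * t) • vecMulVec (J *ᵥ x) (J *ᵥ x) := by
    simp only [eichler, Matrix.transpose_sub, Matrix.transpose_add, Matrix.transpose_one,
      Matrix.transpose_smul, Matrix.transpose_vecMulVec, Matrix.sub_mul, Matrix.add_mul,
      Matrix.one_mul, Matrix.smul_mul, Matrix.vecMulVec_mul, hv]
    rfl
  rw [e1, eichler]
  simp only [Matrix.mul_sub, Matrix.mul_add, Matrix.mul_one, Matrix.mul_smul,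
    Matrix.mul_vecMulVec, Matrix.add_mulVec, Matrix.sub_mulVec, Matrix.smul_mulVec,
    Matrix.vecMulVec_mulVec, hxx', hzx', hxz', hzz', MulOpposite.op_zero, zero_smul,
    smul_zero]
  ext i j
  simp only [Matrix.add_apply, Matrix.sub_apply, Matrix.smul_apply, Matrix.vecMulVec_apply,
    Pi.add_apply, Pi.sub_apply, Pi.smul_apply, Pi.zero_apply, smul_eq_mul, MulOpposite.smul_eq_mul_unop,
    MulOpposite.unop_op]
  field_simp
  ring

lemma eichler_conj {m : ℕ} {J g : Matrix (Fin m) (Fin m) F} (hg : gᵀ * J * g = J)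
    (x z : Fin m → F) : eichler J (g *ᵥ x) (g *ᵥ z) * g = g * eichler J x z := by
  have hv : ∀ y, (J *ᵥ (g *ᵥ y)) ᵥ* g = J *ᵥ y := fun y => by
    rw [← Matrix.mulVec_transpose, Matrix.mulVec_mulVec, Matrix.mulVec_mulVec, hg]
  have hz : (g *ᵥ z) ⬝ᵥ (J *ᵥ (g *ᵥ z)) = z ⬝ᵥ (J *ᵥ z) := by
    rw [dotProduct_comm, Matrix.dotProduct_mulVec, hv, dotProduct_comm]
  simp only [eichler, Matrix.mul_sub, Matrix.mul_add, Matrix.mul_one, Matrix.mul_smul,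
    Matrix.add_mul, Matrix.sub_mul, Matrix.smul_mul, Matrix.mul_vecMulVec, Matrix.vecMulVec_mul,
    Matrix.one_mul, hv, hz]

lemma det_of_upUnip {m : ℕ} {M : Matrix (Fin m) (Fin m) F} (h : upUnip F M) : M.det = 1 := by
  rw [Matrix.det_of_isUpperTriangular]
  · exact Finset.prod_eq_one fun i _ => by rw [h i i le_rfl, if_pos rfl]
  · intro i j hij
    exact (h i j (le_of_lt hij)).trans (if_neg (ne_of_gt hij))

/-- An upper unitriangular isometry, as an element of `SO_{2l}`. -/
def mkSO {l : ℕ} {ρ : F} (M : Matrix (Fin (2*l)) (Fin (2*l)) F) (h : upUnip F M)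
    (hM : Mᵀ * Jrho F l ρ * M = Jrho F l ρ) : SO2l F l ρ :=
  ⟨Matrix.GeneralLinearGroup.mkOfDetNeZero M (by simp [det_of_upUnip h]),
    det_of_upUnip h, hM⟩

lemma mkSO_mem {l : ℕ} {ρ : F} (M : Matrix (Fin (2*l)) (Fin (2*l)) F) (h : upUnip F M)
    (hM : Mᵀ * Jrho F l ρ * M = Jrho F l ρ) : mkSO M h hM ∈ USet F l ρ := h

lemma mat_mkSO {l : ℕ} {ρ : F} (M : Matrix (Fin (2*l)) (Fin (2*l)) F) (h : upUnip F M)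
    (hM : Mᵀ * Jrho F l ρ * M = Jrho F l ρ) : mat F (mkSO M h hM) = M := rfl

lemma mat_mul {m : ℕ} {J : Matrix (Fin m) (Fin m) F} (g h : SOgrp F m J) :
    mat F (g * h) = mat F g * mat F h := rfl

lemma mat_injective {m : ℕ} {J : Matrix (Fin m) (Fin m) F} :
    Function.Injective (fun g : SOgrp F m J => mat F g) :=
  fun _ _ h => Subtype.ext (Units.ext h)

/-- The index of the coordinate functional pairing with row `k` in the generic character. -/
def nextIdx (l k : ℕ) : ℕ := if k + 2 = l then l else k + 1

lemma eichler_upUnip {l : ℕ} (hl : 2 ≤ l) (ρ : F) {k : ℕ} (hk : k + 2 ≤ l)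
    {x z : Fin (2*l) → F} (hx : ∀ i : Fin (2*l), k < i → x i = 0)
    (hz : ∀ i : Fin (2*l), (i : ℕ) ≤ k → (Jrho F l ρ *ᵥ z) i = 0) :
    x ⬝ᵥ Jrho F l ρ *ᵥ x = 0 ∧ x ⬝ᵥ Jrho F l ρ *ᵥ z = 0 ∧
    upUnip F (eichler (Jrho F l ρ) x z) := by
  have hJx : ∀ i : Fin (2*l), (i : ℕ) + k + 1 < 2*l → (Jrho F l ρ *ᵥ x) i = 0 := by
    intro i hi
    rw [Jrho_mulVec hl]
    split_ifs
    · exact hx _ (by omega)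
    · rw [hx _ (by omega), mul_zero]
    · exact hx _ (by rw [Fin.val_rev]; omega)
  have hz' : ∀ i : Fin (2*l), 2*l ≤ (i : ℕ) + k + 1 → z i = 0 := by
    intro i hi
    have := hz (Fin.rev i) (by rw [Fin.val_rev]; omega)
    rw [Jrho_mulVec hl, Fin.rev_rev, if_neg, if_neg] at this
    · exact this
    all_goals rw [Fin.val_rev]; omega
  refine ⟨?_, ?_, ?_⟩
  · refine Finset.sum_eq_zero fun i _ => ?_
    by_cases h : k < (i : ℕ)
    · rw [hx i h, zero_mul]
    · rw [hJx i (by omega), mul_zero]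
  · refine Finset.sum_eq_zero fun i _ => ?_
    by_cases h : k < (i : ℕ)
    · rw [hx i h, zero_mul]
    · rw [hz i (by omega), mul_zero]
  · intro i j hij
    have h1 : x i * (Jrho F l ρ *ᵥ z) j = 0 := by
      by_cases h : k < (i : ℕ)
      · rw [hx i h, zero_mul]
      · rw [hz j (by omega), mul_zero]
    have h2 : z i * (Jrho F l ρ *ᵥ x) j = 0 := by
      by_cases h : 2*l ≤ (i : ℕ) + k + 1
      · rw [hz' i h, zero_mul]
      · rw [hJx j (by omega), mul_zero]
    have h3 : x i * (Jrho F l ρ *ᵥ x) j = 0 := by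
      by_cases h : k < (i : ℕ)
      · rw [hx i h, zero_mul]
      · rw [hJx j (by omega), mul_zero]
    simp [eichler, Matrix.vecMulVec_apply, h1, h2, h3, Matrix.one_apply]

lemma psiU_eichler {l : ℕ} (hl : 2 ≤ l) (ρ : F) (ψ : AddChar F ℂ) {k : ℕ} (hk : k + 2 ≤ l)
    {x z : Fin (2*l) → F} (hx : ∀ i : Fin (2*l), k < i → x i = 0)
    (hz : ∀ i : Fin (2*l), (i : ℕ) ≤ k → (Jrho F l ρ *ᵥ z) i = 0)
    (hz1 : ∀ i : Fin (2*l), (i : ℕ) = nextIdx l k → (Jrho F l ρ *ᵥ z) i = 1) :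
    psiU F l ψ (eichler (Jrho F l ρ) x z) =
      ψ ((if k + 2 = l then 2⁻¹ else 1) * x ⟨k, by omega⟩) := by
  have hJx : ∀ i : Fin (2*l), (i : ℕ) + k + 1 < 2*l → (Jrho F l ρ *ᵥ x) i = 0 := by
    intro i hi
    rw [Jrho_mulVec hl]
    split_ifs
    · exact hx _ (by omega)
    · rw [hx _ (by omega), mul_zero]
    · exact hx _ (by rw [Fin.val_rev]; omega)
  have hN : nextIdx l k < 2 * l := by unfold nextIdx; split_ifs <;> omega
  unfold psiU
  congr 1
  rw [Finset.sum_eq_single ⟨k, by omega⟩, Finset.sum_eq_single ⟨nextIdx l k, hN⟩]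
  · have e : eichler (Jrho F l ρ) x z ⟨k, by omega⟩ ⟨nextIdx l k, hN⟩ = x ⟨k, by omega⟩ := by
      have h0 : (Jrho F l ρ *ᵥ x) ⟨nextIdx l k, hN⟩ = 0 :=
        hJx _ (by simp only [nextIdx]; split_ifs <;> omega)
      have hne : (⟨k, by omega⟩ : Fin (2*l)) ≠ ⟨nextIdx l k, hN⟩ := by
        simp only [nextIdx, ne_eq, Fin.mk.injEq]; split_ifs <;> omega
      simp [eichler, Matrix.vecMulVec_apply, h0, hz1 ⟨nextIdx l k, hN⟩ rfl, hne]
    rw [e]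
    simp only [nextIdx]
    split_ifs <;> first | omega | simp
  · intro j _ hj
    have hj' : (j : ℕ) ≠ nextIdx l k := fun h => hj (Fin.ext h)
    simp only [nextIdx] at hj'
    rw [if_neg, if_neg]
    all_goals dsimp only; split_ifs at hj' <;> omega
  · simp
  · intro i _ hi
    have hi' : (i : ℕ) ≠ k := fun h => hi (Fin.ext h)
    refine Finset.sum_eq_zero fun j _ => ?_
    have key : (i : ℕ) < j → (j : ℕ) ≤ l → ((j : ℕ) = i + 1 ∨ (i : ℕ) + 2 = l) →
        eichler (Jrho F l ρ) x z i j = 0 := by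
      intro h1 h2 h3
      have h4 : x i * (Jrho F l ρ *ᵥ z) j = 0 := by
        by_cases h : k < (i : ℕ)
        · rw [hx i h, zero_mul]
        · rw [hz j (by omega), mul_zero]
      have h5 : (Jrho F l ρ *ᵥ x) j = 0 := hJx j (by omega)
      have h6 : i ≠ j := fun h => by omega
      simp [eichler, Matrix.vecMulVec_apply, h4, h5, h6]
    split_ifs with h h'
    · exact key (by omega) (by omega) (by omega)
    · rw [key (by omega) (by omega) (by omega), mul_zero]
    · rfl
  · simp

/-! ### Support of the Bessel function on the mirabolic part -/

lemma exists_Jrho_mulVec {l : ℕ} (hl : 2 ≤ l) {ρ : F} (hρ : ρ ≠ 0) (w : Fin (2*l) → F) :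
    ∃ z, Jrho F l ρ *ᵥ z = w := by
  refine ⟨fun i => if (i : ℕ) = l - 1 then w i else if (i : ℕ) = l then (-ρ)⁻¹ * w i
    else w (Fin.rev i), ?_⟩
  ext i
  have := i.isLt
  simp only [Jrho_mulVec hl, Fin.val_rev, Fin.rev_rev]
  split_ifs
  · rfl
  · rw [mul_inv_cancel_left₀ (neg_ne_zero.mpr hρ)]
  · omega
  · omega
  · rfl

lemma inv_apply_eq_zero {m k : ℕ} {G H : Matrix (Fin m) (Fin m) F} (hGH : G * H = 1)
    (hG : ∀ i j : Fin m, k < (i : ℕ) → (j : ℕ) ≤ k → G i j = 0) :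
    ∀ i j : Fin m, k < (i : ℕ) → (j : ℕ) ≤ k → H i j = 0 := by
  let _ : Invertible G := ⟨H, mul_eq_one_comm.mp hGH, hGH⟩
  have hbt : G.BlockTriangular (fun i : Fin m => if (i : ℕ) ≤ k then 0 else 1) := by
    intro i j hij
    dsimp only at hij
    split_ifs at hij <;> first | omega | exact hG _ _ (by omega) (by omega)
  have := Matrix.blockTriangular_inv_of_blockTriangular hbt
  rw [Matrix.inv_eq_right_inv hGH] at this
  intro i j hi hj
  apply this
  dsimp only
  rw [if_pos hj, if_neg (by omega)]
  exact zero_lt_one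

lemma addChar_eq_of_forall {ψ : AddChar F ℂ} (hψ : ψ ≠ 1) {a b : F}
    (h : ∀ t : F, ψ (t * a) = ψ (t * b)) : a = b := by
  by_contra hab
  apply hψ
  have hab' : a - b ≠ 0 := sub_ne_zero.mpr hab
  ext s
  have h1 := h (s * (a - b)⁻¹)
  have h2 : s = s * (a - b)⁻¹ * a + -(s * (a - b)⁻¹ * b) := by
    field_simp
    ring
  rw [h2, AddChar.map_add_eq_mul, h1, ← AddChar.map_add_eq_mul, add_neg_cancel,
    AddChar.map_zero_eq_one, AddChar.one_apply]

lemma whittaker_conj_eq {l : ℕ} {ρ : F} {ψ : AddChar F ℂ} {V : Type*} [AddCommGroup V]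
    [Module ℂ V] {π : Representation ℂ (SO2l F l ρ) V} {Γ : V →ₗ[ℂ] ℂ}
    (hΓ : IsWhittaker F l ρ ψ π Γ) {v₀ : V} (hv₀ : IsWhitVec F l ρ ψ π Γ v₀)
    {g u u' : SO2l F l ρ} (hu : u ∈ USet F l ρ) (hu' : u' ∈ USet F l ρ) (h : u' * g = g * u)
    (hg : Γ (π g v₀) ≠ 0) : psiU F l ψ (mat F u') = psiU F l ψ (mat F u) := by
  have h1 : Γ (π (u' * g) v₀) = psiU F l ψ (mat F u') * Γ (π g v₀) := by
    rw [map_mul, Module.End.mul_apply, hΓ.2 _ hu']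
  have h2 : Γ (π (g * u) v₀) = psiU F l ψ (mat F u) * Γ (π g v₀) := by
    rw [map_mul, Module.End.mul_apply, hv₀.2 _ hu, map_smul, map_smul, smul_eq_mul]
  rw [h, h2] at h1
  exact (mul_right_cancel₀ hg h1).symm

/-- The columns `0, …, l-2` and `l` of `M` agree with those of the identity in the rows
`≥ l-1`. -/
def IsMirabolic (l : ℕ) (M : Matrix (Fin (2*l)) (Fin (2*l)) F) : Prop :=
  ∀ i j : Fin (2*l), l - 1 ≤ (i : ℕ) → ((j : ℕ) + 2 ≤ l ∨ (j : ℕ) = l) →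
    M i j = if i = j then 1 else 0

lemma IsMirabolic.row_step {l : ℕ} (hl : 2 ≤ l) {ρ : F} (hρ : ρ ≠ 0) (h2 : (2 : F) ≠ 0)
    {ψ : AddChar F ℂ} (hψ : ψ ≠ 1) {V : Type*} [AddCommGroup V]
    [Module ℂ V] {π : Representation ℂ (SO2l F l ρ) V} {Γ : V →ₗ[ℂ] ℂ}
    (hΓ : IsWhittaker F l ρ ψ π Γ) {v₀ : V} (hv₀ : IsWhitVec F l ρ ψ π Γ v₀)
    {g : SO2l F l ρ} (hM : IsMirabolic l (mat F g)) (hg : Γ (π g v₀) ≠ 0)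
    (k : Fin (2*l)) (hk : (k : ℕ) + 2 ≤ l)
    (hS : ∀ i j : Fin (2*l), k < i → (i : ℕ) + 2 ≤ l → j ≤ i →
      mat F g i j = if i = j then 1 else 0) (j : Fin (2*l)) (hj : j ≤ k) :
    mat F g k j = if k = j then 1 else 0 := by
  set G := mat F g with hGdef
  set H := mat F g⁻¹ with hHdef
  have hHG : H * G = 1 := by rw [hHdef, hGdef, ← mat_mul, inv_mul_cancel]; rfl
  have hGH : G * H = 1 := by rw [hHdef, hGdef, ← mat_mul, mul_inv_cancel]; rfl
  have hG : Gᵀ * Jrho F l ρ * G = Jrho F l ρ := g.2.2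
  have hN : nextIdx l k < 2 * l := by unfold nextIdx; split_ifs <;> omega
  have hkN : (k : ℕ) < nextIdx l k := by unfold nextIdx; split_ifs <;> omega
  have hrow : ∀ i j : Fin (2*l), k < i → ((j : ℕ) ≤ k ∨ (j : ℕ) = nextIdx l k) →
      G i j = if i = j then 1 else 0 := by
    intro i j hi hj
    rw [Fin.lt_def] at hi
    by_cases hi' : (i : ℕ) + 2 ≤ l
    · refine hS i j hi hi' ?_
      rw [Fin.le_def]
      unfold nextIdx at hj
      split_ifs at hj <;> omega
    · refine hM i j (by omega) ?_
      unfold nextIdx at hj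
      split_ifs at hj <;> omega
  have hG0 : ∀ i j : Fin (2*l), (k : ℕ) < i → (j : ℕ) ≤ k → G i j = 0 := by
    intro i j hi hj
    rw [hrow i j hi (Or.inl hj), if_neg]
    rintro rfl
    omega
  have hH0 := inv_apply_eq_zero hGH hG0
  have hH1 : H ⟨nextIdx l k, hN⟩ ⟨nextIdx l k, hN⟩ = 1 := by
    have := congrFun (congrFun hHG ⟨nextIdx l k, hN⟩) ⟨nextIdx l k, hN⟩
    rw [Matrix.mul_apply, Finset.sum_eq_single ⟨nextIdx l k, hN⟩, Matrix.one_apply_eq,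
      hrow _ _ hkN (Or.inr rfl), if_pos rfl, mul_one] at this
    · exact this
    · intro s _ hs
      by_cases hsk : (k : ℕ) < s
      · rw [hrow s _ hsk (Or.inr rfl), if_neg hs, mul_zero]
      · rw [hH0 _ _ hkN (by omega), zero_mul]
    · simp
  obtain ⟨z, hz⟩ := exists_Jrho_mulVec hl hρ (Pi.single (⟨nextIdx l k, hN⟩ : Fin (2*l)) (1 : F))
  have hGz : Jrho F l ρ *ᵥ (G *ᵥ z) = fun i => H ⟨nextIdx l k, hN⟩ i := by
    have e : Jrho F l ρ * G = Hᵀ * Jrho F l ρ := by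
      calc Jrho F l ρ * G = (G * H)ᵀ * (Jrho F l ρ * G) := by rw [hGH]; simp
        _ = Hᵀ * (Gᵀ * Jrho F l ρ * G) := by
          rw [Matrix.transpose_mul]; simp only [Matrix.mul_assoc]
        _ = _ := by rw [hG]
    rw [Matrix.mulVec_mulVec, e, ← Matrix.mulVec_mulVec, hz]
    ext i
    simp
  have hz0 : ∀ i : Fin (2*l), (i : ℕ) ≤ k → (Jrho F l ρ *ᵥ z) i = 0 := by
    intro i hi
    rw [hz, Pi.single_eq_of_ne]
    rintro rfl
    simp only at hi
    omega
  have hz1 : ∀ i : Fin (2*l), (i : ℕ) = nextIdx l k → (Jrho F l ρ *ᵥ z) i = 1 := by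
    intro i hi
    obtain rfl : i = ⟨nextIdx l k, hN⟩ := Fin.ext hi
    rw [hz, Pi.single_eq_same]
  have hGz0 : ∀ i : Fin (2*l), (i : ℕ) ≤ k → (Jrho F l ρ *ᵥ (G *ᵥ z)) i = 0 := by
    intro i hi
    rw [hGz]
    exact hH0 _ _ hkN hi
  have hGz1 : ∀ i : Fin (2*l), (i : ℕ) = nextIdx l k →
      (Jrho F l ρ *ᵥ (G *ᵥ z)) i = 1 := by
    intro i hi
    obtain rfl : i = ⟨nextIdx l k, hN⟩ := Fin.ext hi
    rw [hGz]
    exact hH1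
  set c : F := if (k : ℕ) + 2 = l then 2⁻¹ else 1 with hc
  have hc0 : c ≠ 0 := by
    rw [hc]
    split_ifs
    · exact inv_ne_zero h2
    · exact one_ne_zero
  apply mul_left_cancel₀ hc0
  apply addChar_eq_of_forall hψ
  intro t
  set x : Fin (2*l) → F := Pi.single j t with hx
  have hxk : x k = t * if k = j then 1 else 0 := by
    rw [hx, Pi.single_apply, mul_ite, mul_one, mul_zero]
  have hGxi : ∀ i, (G *ᵥ x) i = t * G i j := by
    intro i
    rw [hx, Matrix.mulVec_single]
    simp [mul_comm]
  have hx0 : ∀ i : Fin (2*l), (k : ℕ) < i → x i = 0 := by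
    intro i hi
    rw [hx, Pi.single_eq_of_ne]
    rintro rfl
    rw [Fin.le_def] at hj
    omega
  have hGx0 : ∀ i : Fin (2*l), (k : ℕ) < i → (G *ᵥ x) i = 0 := by
    intro i hi
    rw [hGxi, hG0 i j hi hj, mul_zero]
  obtain ⟨a1, a2, a3⟩ := eichler_upUnip hl ρ hk hx0 hz0
  obtain ⟨b1, b2, b3⟩ := eichler_upUnip hl ρ hk hGx0 hGz0
  have hJ := Jrho_transpose hl ρ
  have key := whittaker_conj_eq hΓ hv₀ (mkSO_mem _ a3 (eichler_form h2 hJ a1 a2))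
    (mkSO_mem _ b3 (eichler_form h2 hJ b1 b2)) (g := g)
    (mat_injective (by
      simp only [mat_mul, mat_mkSO]
      exact eichler_conj hG x z)) hg
  rw [mat_mkSO, mat_mkSO, psiU_eichler hl ρ ψ hk hx0 hz0 hz1,
    psiU_eichler hl ρ ψ hk hGx0 hGz0 hGz1, hxk, hGxi] at key
  rw [mul_left_comm, mul_left_comm t c]
  exact key

lemma IsMirabolic.rows {l : ℕ} (hl : 2 ≤ l) {ρ : F} (hρ : ρ ≠ 0) (h2 : (2 : F) ≠ 0)
    {ψ : AddChar F ℂ} (hψ : ψ ≠ 1) {V : Type*} [AddCommGroup V]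
    [Module ℂ V] {π : Representation ℂ (SO2l F l ρ) V} {Γ : V →ₗ[ℂ] ℂ}
    (hΓ : IsWhittaker F l ρ ψ π Γ) {v₀ : V} (hv₀ : IsWhitVec F l ρ ψ π Γ v₀)
    {g : SO2l F l ρ} (hM : IsMirabolic l (mat F g)) (hg : Γ (π g v₀) ≠ 0) (n : ℕ) :
    ∀ i j : Fin (2*l), l ≤ (i : ℕ) + 1 + n → (i : ℕ) + 2 ≤ l → j ≤ i →
      mat F g i j = if i = j then 1 else 0 := by
  induction n with
  | zero => intro i j h1 h2; omega
  | succ n ih =>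
    intro i j h1 h2' hj
    exact hM.row_step hl hρ h2 hψ hΓ hv₀ hg i h2'
      (fun i' j' hi' => ih i' j' (by rw [Fin.lt_def] at hi'; omega)) j hj

lemma IsMirabolic.upUnip_of_rows {l : ℕ} (hl : 2 ≤ l) {ρ : F} (hρ : ρ ≠ 0) {g : SO2l F l ρ}
    (hM : IsMirabolic l (mat F g))
    (hR : ∀ i j : Fin (2*l), (i : ℕ) + 2 ≤ l → j ≤ i →
      mat F g i j = if i = j then 1 else 0) : upUnip F (mat F g) := by
  set G := mat F g with hGdef
  have hG : Gᵀ * Jrho F l ρ * G = Jrho F l ρ := g.2.2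
  have hdet : G.det = 1 := g.2.1
  have hpair : ∀ i j, ∑ s, G s i * (Jrho F l ρ *ᵥ fun t => G t j) s = Jrho F l ρ i j := by
    intro i j
    conv_rhs => rw [← hG, Matrix.mul_assoc, Matrix.mul_apply]
    rfl
  have hlow : ∀ n : ℕ, ∀ i j : Fin (2*l), (i : ℕ) + 2 ≤ l → (i : ℕ) ≤ n → l - 1 ≤ (j : ℕ) →
      (j : ℕ) ≠ l → (i : ℕ) + j + 1 ≤ 2*l →
      G (Fin.rev i) j = if Fin.rev i = j then 1 else 0 := by
    intro n
    induction n using Nat.strong_induction_on with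
    | _ n ih =>
      intro i j hi hin hj hjl hij
      have h := hpair i j
      rw [Finset.sum_eq_single i, hR i i hi le_rfl, if_pos rfl, one_mul, Jrho_mulVec hl,
        if_neg (by omega), if_neg (by omega), Jrho_apply hl, if_neg (by omega),
        if_neg (by omega)] at h
      · rw [h]
        simp only [eq_comm]
      · intro s _ hs
        have hs' : (s : ℕ) ≠ i := fun h => hs (Fin.ext h)
        by_cases hsi : (s : ℕ) < i
        · rw [Jrho_mulVec hl, if_neg (by omega), if_neg (by omega),
            ih (s : ℕ) (by omega) s j (by omega) le_rfl hj hjl (by omega), if_neg, mul_zero]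
          intro h
          rw [Fin.ext_iff, Fin.val_rev] at h
          omega
        · by_cases hsl : (s : ℕ) + 2 ≤ l
          · rw [hR s i hsl (by rw [Fin.le_def]; omega), if_neg hs, zero_mul]
          · rw [hM s i (by omega) (Or.inl hi), if_neg hs, zero_mul]
      · simp
  have hmid : ∀ j i : Fin (2*l), (j : ℕ) = l - 1 → (i : ℕ) = l → G i j = 0 := by
    intro j i hj hi
    have h := hpair j i
    rw [Finset.sum_eq_single i, Jrho_mulVec hl, if_neg (by omega), if_pos hi, Jrho_apply hl,
      if_pos hj, if_neg (fun h => by omega), hM i i (by omega) (Or.inr hi), if_pos rfl] at h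
    · simpa [hρ] using h
    · intro s _ hs
      have hs' : (s : ℕ) ≠ i := fun h => hs (Fin.ext h)
      have hslt := s.isLt
      by_cases h1 : (s : ℕ) = l - 1
      · rw [Jrho_mulVec hl, if_pos h1, hM s i (by omega) (Or.inr hi), if_neg hs, mul_zero]
      · by_cases h2 : (s : ℕ) + 2 ≤ l
        · rw [Jrho_mulVec hl, if_neg h1, if_neg (by omega),
            hM (Fin.rev s) i (by rw [Fin.val_rev]; omega) (Or.inr hi), if_neg, mul_zero]
          intro h
          rw [Fin.ext_iff, Fin.val_rev] at h
          omega
        · have h3 := hlow (Fin.rev s : Fin (2*l)) (Fin.rev s) j (by rw [Fin.val_rev]; omega) le_rfl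
            (by omega) (by omega) (by rw [Fin.val_rev]; omega)
          rw [Fin.rev_rev, if_neg (fun h => by omega)] at h3
          rw [h3, zero_mul]
    · simp
  have hoff : ∀ i j : Fin (2*l), j ≤ i → ¬ ((i : ℕ) = l - 1 ∧ (j : ℕ) = l - 1) →
      G i j = if i = j then 1 else 0 := by
    intro i j hji hne
    have hilt := i.isLt
    rw [Fin.le_def] at hji
    by_cases h1 : (i : ℕ) + 2 ≤ l
    · exact hR i j h1 hji
    · by_cases h2 : (j : ℕ) + 2 ≤ l ∨ (j : ℕ) = l
      · exact hM i j (by omega) h2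
      · by_cases h3 : (i : ℕ) = l
        · rw [hmid j i (by omega) h3, if_neg (fun h => by omega)]
        · have h4 := hlow (Fin.rev i : Fin (2*l)) (Fin.rev i) j (by rw [Fin.val_rev]; omega) le_rfl
            (by omega) (by omega) (by rw [Fin.val_rev]; omega)
          rwa [Fin.rev_rev] at h4
  have hdiag : G ⟨l - 1, by omega⟩ ⟨l - 1, by omega⟩ = 1 := by
    rw [Matrix.det_of_isUpperTriangular, Finset.prod_eq_single ⟨l - 1, by omega⟩] at hdet
    · exact hdet
    · intro i _ hi
      rw [hoff i i le_rfl, if_pos rfl]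
      exact fun h => hi (Fin.ext h.1)
    · simp
    · intro i j hij
      refine (hoff i j (le_of_lt hij) fun h => ?_).trans (if_neg (ne_of_gt hij))
      have : (j : ℕ) < i := hij
      omega
  intro i j hij
  by_cases h : (i : ℕ) = l - 1 ∧ (j : ℕ) = l - 1
  · have hi : i = ⟨l - 1, by omega⟩ := Fin.ext h.1
    have hj : j = i := Fin.ext (h.2.trans h.1.symm)
    rw [hj, if_pos rfl]
    exact (congrArg (fun s => G s s) hi).trans hdiag
  · exact hoff i j hij h

/-- On the mirabolic part, the Bessel function is supported on the unipotent group. -/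
lemma IsMirabolic.mem_USet {l : ℕ} (hl : 2 ≤ l) {ρ : F} (hρ : ρ ≠ 0) (h2 : (2 : F) ≠ 0)
    {ψ : AddChar F ℂ} (hψ : ψ ≠ 1) {V : Type*} [AddCommGroup V]
    [Module ℂ V] {π : Representation ℂ (SO2l F l ρ) V} {Γ : V →ₗ[ℂ] ℂ}
    (hΓ : IsWhittaker F l ρ ψ π Γ) {v₀ : V} (hv₀ : IsWhitVec F l ρ ψ π Γ v₀)
    {g : SO2l F l ρ} (hM : IsMirabolic l (mat F g)) (hg : Γ (π g v₀) ≠ 0) :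
    g ∈ USet F l ρ :=
  hM.upUnip_of_rows hl hρ fun i j hi hj =>
    hM.rows hl hρ h2 hψ hΓ hv₀ hg l i j (by omega) hi hj

lemma USet.mid_eq_zero {l : ℕ} (hl : 2 ≤ l) {ρ : F} {g : SO2l F l ρ} (hg : g ∈ USet F l ρ)
    (i j : Fin (2*l)) (hi : (i : ℕ) = l - 1) (hj : (j : ℕ) = l) : mat F g i j = 0 := by
  have hG : (mat F g)ᵀ * Jrho F l ρ * mat F g = Jrho F l ρ := g.2.2
  have h := congrFun (congrFun hG i) j
  rw [Matrix.mul_assoc, Matrix.mul_apply, Finset.sum_eq_single i, Jrho_apply hl, if_pos hi,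
    if_neg (fun h => by omega)] at h
  · have e : (Jrho F l ρ * mat F g) i j = mat F g i j :=
      (Jrho_mulVec hl ρ (fun t => mat F g t j) i).trans (if_pos hi)
    rw [e, Matrix.transpose_apply, hg i i le_rfl, if_pos rfl, one_mul] at h
    exact h
  · intro s _ hs
    have hs' : (s : ℕ) ≠ i := fun h => hs (Fin.ext h)
    have hslt := s.isLt
    rw [Matrix.transpose_apply]
    by_cases h1 : (s : ℕ) < i
    · have e : (Jrho F l ρ * mat F g) s j = mat F g (Fin.rev s) j :=
        (Jrho_mulVec hl ρ (fun t => mat F g t j) s).trans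
          (by rw [if_neg (by omega), if_neg (by omega)])
      rw [e, hg (Fin.rev s) j (by rw [Fin.val_rev]; omega), if_neg, mul_zero]
      intro h
      rw [Fin.ext_iff, Fin.val_rev] at h
      omega
    · rw [hg s i (by omega), if_neg hs, zero_mul]
  · simp

/-! ### The Siegel Levi subgroup -/

lemma sum_fin_two_mul {M : Type*} [AddCommMonoid M] {l : ℕ} (f : Fin (2*l) → M) :
    ∑ k, f k = (∑ k : Fin l, f ⟨k, by omega⟩) + ∑ k : Fin l, f ⟨l + k, by omega⟩ := by
  rw [← (finCongr (by omega : l + l = 2 * l)).sum_comp, Fin.sum_univ_add]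
  rfl

lemma sum_fin_two_mul_add_one {M : Type*} [AddCommMonoid M] {l : ℕ} (f : Fin (2*l+1) → M) :
    ∑ k, f k = (∑ k : Fin l, f ⟨k, by omega⟩) + f ⟨l, by omega⟩
      + ∑ k : Fin l, f ⟨l + 1 + k, by omega⟩ := by
  rw [← (finCongr (by omega : l + 1 + l = 2 * l + 1)).sum_comp, Fin.sum_univ_add,
    Fin.sum_univ_castSucc]
  rfl

lemma fin_two_mul_add_one_cases {l : ℕ} (i : Fin (2*l+1)) :
    (∃ a : Fin l, i = ⟨a, by omega⟩) ∨ i = ⟨l, by omega⟩ ∨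
      ∃ a : Fin l, i = ⟨l + 1 + a, by omega⟩ := by
  have := i.isLt
  rcases lt_trichotomy (i : ℕ) l with h | h | h
  · exact Or.inl ⟨⟨i, h⟩, rfl⟩
  · exact Or.inr (Or.inl (Fin.ext h))
  · exact Or.inr (Or.inr ⟨⟨i - (l + 1), by omega⟩, Fin.ext (by simp only; omega)⟩)

section Levi

variable {l : ℕ} (a b : Matrix (Fin l) (Fin l) F)

lemma lnMat_tl (i j : Fin l) : lnMat F l a ⟨i, by omega⟩ ⟨j, by omega⟩ = a i j := by
  simp [lnMat]

lemma lnMat_tm (i : Fin l) : lnMat F l a ⟨i, by omega⟩ ⟨l, by omega⟩ = 0 := by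
  simp [lnMat]

lemma lnMat_tr (i j : Fin l) : lnMat F l a ⟨i, by omega⟩ ⟨l + 1 + j, by omega⟩ = 0 := by
  simp [lnMat]
  omega

lemma lnMat_ml (j : Fin l) : lnMat F l a ⟨l, by omega⟩ ⟨j, by omega⟩ = 0 := by
  have := j.isLt
  simp [lnMat]
  omega

lemma lnMat_mm : lnMat F l a ⟨l, by omega⟩ ⟨l, by omega⟩ = 1 := by
  simp [lnMat]

lemma lnMat_mr (j : Fin l) : lnMat F l a ⟨l, by omega⟩ ⟨l + 1 + j, by omega⟩ = 0 := by
  simp [lnMat]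
  omega

lemma lnMat_bl (i j : Fin l) : lnMat F l a ⟨l + 1 + i, by omega⟩ ⟨j, by omega⟩ = 0 := by
  have := j.isLt
  simp only [lnMat, Matrix.of_apply]
  rw [dif_neg (by omega), dif_neg (by omega), dif_neg (by omega)]

lemma lnMat_bm (i : Fin l) : lnMat F l a ⟨l + 1 + i, by omega⟩ ⟨l, by omega⟩ = 0 := by
  simp only [lnMat, Matrix.of_apply]
  rw [dif_neg (by omega), dif_neg (by omega), dif_neg (by omega)]

lemma lnMat_br (i j : Fin l) :
    lnMat F l a ⟨l + 1 + i, by omega⟩ ⟨l + 1 + j, by omega⟩ = aStar F l a i j := by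
  simp only [lnMat, Matrix.of_apply]
  rw [dif_neg (by omega), dif_neg (by omega), dif_pos (by omega)]
  simp

variable {o : Type*} (X : Matrix (Fin (2*l+1)) o F)

lemma lnMat_mul_top (i : Fin l) (j : o) :
    (lnMat F l a * X) ⟨i, by omega⟩ j = ∑ k : Fin l, a i k * X ⟨k, by omega⟩ j := by
  rw [Matrix.mul_apply, sum_fin_two_mul_add_one]
  simp only [lnMat_tl, lnMat_tm, lnMat_tr, zero_mul, Finset.sum_const_zero, add_zero]

lemma lnMat_mul_mid (j : o) : (lnMat F l a * X) ⟨l, by omega⟩ j = X ⟨l, by omega⟩ j := by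
  rw [Matrix.mul_apply, sum_fin_two_mul_add_one]
  simp only [lnMat_ml, lnMat_mm, lnMat_mr, zero_mul, one_mul, Finset.sum_const_zero, add_zero,
    zero_add]

lemma lnMat_mul_bot (i : Fin l) (j : o) :
    (lnMat F l a * X) ⟨l + 1 + i, by omega⟩ j =
      ∑ k : Fin l, aStar F l a i k * X ⟨l + 1 + k, by omega⟩ j := by
  rw [Matrix.mul_apply, sum_fin_two_mul_add_one]
  simp only [lnMat_bl, lnMat_bm, lnMat_br, zero_mul, Finset.sum_const_zero, zero_add]

lemma aStar_apply (i j : Fin l) : aStar F l a i j = a⁻¹ (Fin.rev j) (Fin.rev i) := by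
  rw [aStar, mul_Jmat_apply, Jmat_mul_apply, Matrix.transpose_apply]

lemma aStar_mul : aStar F l (a * b) = aStar F l a * aStar F l b := by
  simp only [aStar, Matrix.mul_inv_rev, Matrix.transpose_mul]
  calc _ = Jmat F l * (a⁻¹ᵀ * 1 * b⁻¹ᵀ) * Jmat F l := by rw [Matrix.mul_one]
    _ = _ := by rw [← Jmat_mul_self l]; simp only [Matrix.mul_assoc]

lemma lnMat_mul : lnMat F l (a * b) = lnMat F l a * lnMat F l b := by
  ext i j
  rcases fin_two_mul_add_one_cases i with ⟨i, rfl⟩ | rfl | ⟨i, rfl⟩ <;>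
  rcases fin_two_mul_add_one_cases j with ⟨j, rfl⟩ | rfl | ⟨j, rfl⟩ <;>
  simp only [lnMat_mul_top, lnMat_mul_mid, lnMat_mul_bot, lnMat_tl, lnMat_tm, lnMat_tr, lnMat_ml,
    lnMat_mm, lnMat_mr, lnMat_bl, lnMat_bm, lnMat_br, mul_zero, Finset.sum_const_zero, aStar_mul] <;>
  rw [Matrix.mul_apply]

lemma wllMat_eq_lnMat (ρ : F) : wllMat F l ρ = lnMat F l ((ρ/2) • (1 : Matrix (Fin l) (Fin l) F)) := by
  have hinv : ((ρ/2) • (1 : Matrix (Fin l) (Fin l) F))⁻¹ = (ρ/2)⁻¹ • 1 := by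
    rcases eq_or_ne (ρ/2) 0 with h | h
    · rw [h, zero_smul, _root_.inv_zero, zero_smul, Matrix.inv_zero]
    · exact Matrix.inv_eq_right_inv (by
        rw [Matrix.smul_mul, Matrix.one_mul, smul_smul, mul_inv_cancel₀ h, one_smul])
  ext i j
  rcases fin_two_mul_add_one_cases i with ⟨i, rfl⟩ | rfl | ⟨i, rfl⟩ <;>
  rcases fin_two_mul_add_one_cases j with ⟨j, rfl⟩ | rfl | ⟨j, rfl⟩ <;>
  simp only [lnMat_tl, lnMat_tm, lnMat_tr, lnMat_ml,
    lnMat_mm, lnMat_mr, lnMat_bl, lnMat_bm, lnMat_br, aStar_apply, hinv, Matrix.smul_apply,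
    Matrix.one_apply, wllMat, Matrix.of_apply, Fin.ext_iff, Fin.val_rev, smul_eq_mul] <;>
  split_ifs <;> first | omega | simp

lemma lnMat_one : lnMat F l (1 : Matrix (Fin l) (Fin l) F) = 1 := by
  ext i j
  rcases fin_two_mul_add_one_cases i with ⟨i, rfl⟩ | rfl | ⟨i, rfl⟩ <;>
  rcases fin_two_mul_add_one_cases j with ⟨j, rfl⟩ | rfl | ⟨j, rfl⟩ <;>
  simp only [lnMat_tl, lnMat_tm, lnMat_tr, lnMat_ml,
    lnMat_mm, lnMat_mr, lnMat_bl, lnMat_bm, lnMat_br, aStar_apply, inv_one,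
    Matrix.one_apply, Fin.ext_iff, Fin.val_rev] <;>
  split_ifs <;> first | omega | rfl

lemma lnMat_form (p : GL (Fin l) F) :
    (lnMat F l (p : Matrix (Fin l) (Fin l) F))ᵀ * Jmat F (2*l+1) *
      lnMat F l (p : Matrix (Fin l) (Fin l) F) = Jmat F (2*l+1) := by
  set P := (p : Matrix (Fin l) (Fin l) F) with hP
  set Q := ((p⁻¹ : GL (Fin l) F) : Matrix (Fin l) (Fin l) F) with hQ
  have hQP : Q * P = 1 := by rw [hP, hQ, ← Units.val_mul, inv_mul_cancel, Units.val_one]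
  have hPQ : P * Q = 1 := by rw [hP, hQ, ← Units.val_mul, mul_inv_cancel, Units.val_one]
  have e : (lnMat F l P)ᵀ * Jmat F (2*l+1) = Jmat F (2*l+1) * lnMat F l Q := by
    ext i j
    rw [mul_Jmat_apply, Jmat_mul_apply, Matrix.transpose_apply]
    have r1 : ∀ s : Fin l, Fin.rev (⟨s, by omega⟩ : Fin (2*l+1))
        = ⟨l + 1 + Fin.rev s, by omega⟩ := fun s => by
      rw [Fin.ext_iff, Fin.val_rev]
      simp only [Fin.val_rev]
      omega
    have r2 : Fin.rev (⟨l, by omega⟩ : Fin (2*l+1)) = ⟨l, by omega⟩ := by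
      rw [Fin.ext_iff, Fin.val_rev]
      simp only
      omega
    have r3 : ∀ s : Fin l, Fin.rev (⟨l + 1 + s, by omega⟩ : Fin (2*l+1))
        = ⟨Fin.rev s, by omega⟩ := fun s => by
      rw [Fin.ext_iff, Fin.val_rev]
      simp only [Fin.val_rev]
      omega
    rcases fin_two_mul_add_one_cases i with ⟨i, rfl⟩ | rfl | ⟨i, rfl⟩ <;>
    rcases fin_two_mul_add_one_cases j with ⟨j, rfl⟩ | rfl | ⟨j, rfl⟩ <;>
    simp only [r1, r2, r3, lnMat_tl, lnMat_tm, lnMat_tr, lnMat_ml,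
      lnMat_mm, lnMat_mr, lnMat_bl, lnMat_bm, lnMat_br, aStar_apply, Fin.rev_rev,
      Matrix.inv_eq_right_inv hPQ, Matrix.inv_eq_right_inv hQP]
  rw [e, Matrix.mul_assoc, ← lnMat_mul, hQP, lnMat_one, Matrix.mul_one]

end Levi

lemma apply_of_mem_VnSet {l : ℕ} {u : Matrix (Fin (2*l+1)) (Fin (2*l+1)) F} (hu : u ∈ VnSet F l)
    (i j : Fin (2*l+1)) (hj : (j : ℕ) < l) : u i j = if i = j then 1 else 0 := by
  apply hu.2
  simp only [blkSiegel]
  split_ifs <;> omega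

lemma lnMat_mul_apply_top {l : ℕ} (a : Matrix (Fin l) (Fin l) F)
    {u : Matrix (Fin (2*l+1)) (Fin (2*l+1)) F} (hu : u ∈ VnSet F l) (i j : Fin l) :
    (lnMat F l a * u) ⟨i, by omega⟩ ⟨j, by omega⟩ = a i j := by
  rw [lnMat_mul_top, Finset.sum_eq_single j]
  · rw [apply_of_mem_VnSet hu _ _ j.isLt, if_pos rfl, mul_one]
  · intro k _ hk
    rw [apply_of_mem_VnSet hu _ _ j.isLt, if_neg, mul_zero]
    intro h
    exact hk (Fin.ext (Fin.mk.inj h))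
  · simp

lemma lnMat_mul_apply_low {l : ℕ} (a : Matrix (Fin l) (Fin l) F)
    {u : Matrix (Fin (2*l+1)) (Fin (2*l+1)) F} (hu : u ∈ VnSet F l) (i j : Fin (2*l+1))
    (hi : l ≤ (i : ℕ)) (hj : (j : ℕ) < l) : (lnMat F l a * u) i j = 0 := by
  have hu0 : ∀ k : Fin (2*l+1), l ≤ (k : ℕ) → u k j = 0 := fun k hk => by
    rw [apply_of_mem_VnSet hu k j hj, if_neg]
    rintro rfl
    omega
  rcases fin_two_mul_add_one_cases i with ⟨i, rfl⟩ | rfl | ⟨i, rfl⟩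
  · have := i.isLt
    simp only at hi
    omega
  · rw [lnMat_mul_mid, hu0 _ le_rfl]
  · rw [lnMat_mul_bot]
    exact Finset.sum_eq_zero fun k _ => by rw [hu0 _ (by simp only; omega), mul_zero]

section Whittaker

variable {l : ℕ} {Wτ : Type*} [AddCommGroup Wτ] [Module ℂ Wτ]
  (τ : Representation ℂ (GL (Fin l) F) Wτ) (Λ : Wτ →ₗ[ℂ] ℂ) (v : Wτ)

lemma xiv_lnMat_mul (p : GL (Fin l) F) {u : Matrix (Fin (2*l+1)) (Fin (2*l+1)) F}
    (hu : u ∈ VnSet F l) :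
    xiv F l τ v (lnMat F l (p : Matrix (Fin l) (Fin l) F) * u) = τ p v := by
  have h : ∃ q : (GL (Fin l) F) × Matrix (Fin (2*l+1)) (Fin (2*l+1)) F,
      q.2 ∈ VnSet F l ∧ lnMat F l (p : Matrix (Fin l) (Fin l) F) * u
        = lnMat F l ((q.1 : Matrix (Fin l) (Fin l) F)) * q.2 := ⟨(p, u), hu, rfl⟩
  rw [xiv, dif_pos h]
  have hp : h.choose.1 = p := by
    apply Units.ext
    ext i j
    rw [← lnMat_mul_apply_top (h.choose.1 : Matrix (Fin l) (Fin l) F) h.choose_spec.1 i j,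
      ← h.choose_spec.2, lnMat_mul_apply_top _ hu]
  rw [hp]

lemma tauApp_one : tauApp F l τ 1 = 1 := by
  have h : ∃ g : GL (Fin l) F, (g : Matrix (Fin l) (Fin l) F) = 1 := ⟨1, rfl⟩
  rw [tauApp, matFun, dif_pos h]
  have : h.choose = 1 := Units.ext h.choose_spec
  rw [this, map_one]

lemma fvFun_lnMat_mul (p : GL (Fin l) F) {u : Matrix (Fin (2*l+1)) (Fin (2*l+1)) F}
    (hu : u ∈ VnSet F l) :
    fvFun F l τ Λ v (lnMat F l (p : Matrix (Fin l) (Fin l) F) * u) 1 = Λ (τ p v) := by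
  rw [fvFun, tauApp_one, xiv_lnMat_mul _ _ _ hu]
  rfl

lemma fvFun_support {m : Matrix (Fin (2*l+1)) (Fin (2*l+1)) F} (hm : fvFun F l τ Λ v m 1 ≠ 0)
    (i j : Fin (2*l+1)) (hi : l ≤ (i : ℕ)) (hj : (j : ℕ) < l) : m i j = 0 := by
  by_cases h : ∃ q : (GL (Fin l) F) × Matrix (Fin (2*l+1)) (Fin (2*l+1)) F,
      q.2 ∈ VnSet F l ∧ m = lnMat F l ((q.1 : Matrix (Fin l) (Fin l) F)) * q.2
  · obtain ⟨q, hq, rfl⟩ := h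
    exact lnMat_mul_apply_low _ hq i j hi hj
  · refine absurd ?_ hm
    rw [fvFun, xiv, dif_neg h, map_zero, map_zero]

end Whittaker

lemma one_mem_VnSet (l : ℕ) : (1 : Matrix (Fin (2*l+1)) (Fin (2*l+1)) F) ∈ VnSet F l :=
  ⟨⟨by simp, by simp⟩, fun i j _ => Matrix.one_apply⟩

/-- An upper unitriangular isometry lies in the Siegel parabolic subgroup. -/
lemma exists_lnMat_mul {l : ℕ} {Y : Matrix (Fin (2*l+1)) (Fin (2*l+1)) F} (hY : upUnip F Y)
    (hJ : Yᵀ * Jmat F (2*l+1) * Y = Jmat F (2*l+1)) :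
    ∃ p : GL (Fin l) F, ∃ u ∈ VnSet F l,
      (∀ i j : Fin l, (p : Matrix (Fin l) (Fin l) F) i j = Y ⟨i, by omega⟩ ⟨j, by omega⟩) ∧
      upUnip F (p : Matrix (Fin l) (Fin l) F) ∧
      Y = lnMat F l (p : Matrix (Fin l) (Fin l) F) * u := by
  set P : Matrix (Fin l) (Fin l) F :=
    Matrix.of fun i j => Y ⟨i, by omega⟩ ⟨j, by omega⟩ with hP
  have hPu : upUnip F P := by
    intro i j hij
    rw [hP, Matrix.of_apply, hY _ _ hij]
    simp [Fin.ext_iff]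
  set p : GL (Fin l) F :=
    Matrix.GeneralLinearGroup.mkOfDetNeZero P (by simp [det_of_upUnip hPu]) with hp
  have hpP : (p : Matrix (Fin l) (Fin l) F) = P := rfl
  set Q := ((p⁻¹ : GL (Fin l) F) : Matrix (Fin l) (Fin l) F) with hQ
  have hQP : Q * P = 1 := by rw [← hpP, hQ, ← Units.val_mul, inv_mul_cancel, Units.val_one]
  have hPQ : P * Q = 1 := by rw [← hpP, hQ, ← Units.val_mul, mul_inv_cancel, Units.val_one]
  set u := lnMat F l Q * Y with hu
  have huJ : uᵀ * Jmat F (2*l+1) * u = Jmat F (2*l+1) := by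
    calc uᵀ * Jmat F (2*l+1) * u
        = Yᵀ * ((lnMat F l Q)ᵀ * Jmat F (2*l+1) * lnMat F l Q) * Y := by
          rw [hu, Matrix.transpose_mul]; simp only [Matrix.mul_assoc]
      _ = _ := by rw [lnMat_form, hJ]
  have htl : ∀ i j : Fin (2*l+1), (j : ℕ) < l → u i j = if i = j then 1 else 0 := by
    intro i j hj
    rcases fin_two_mul_add_one_cases i with ⟨i, rfl⟩ | rfl | ⟨i, rfl⟩
    · have h := congrFun (congrFun hQP i) ⟨j, hj⟩
      rw [Matrix.mul_apply] at h
      rw [hu, lnMat_mul_top]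
      refine h.trans ?_
      simp [Matrix.one_apply, Fin.ext_iff]
    · rw [hu, lnMat_mul_mid, hY _ _ (by simp only; omega)]
    · have hi : (⟨l + 1 + i, by omega⟩ : Fin (2*l+1)) ≠ j := by
        intro h
        rw [← h] at hj
        simp only at hj
        omega
      rw [hu, lnMat_mul_bot, if_neg hi]
      refine Finset.sum_eq_zero fun k _ => ?_
      rw [hY _ _ (by simp only; omega), if_neg, mul_zero]
      intro h
      rw [← h] at hj
      simp only at hj
      omega
  have hmid : ∀ i j : Fin (2*l+1), l ≤ (i : ℕ) → (j : ℕ) = l → u i j = if i = j then 1 else 0 := by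
    intro i j hi hj
    rcases fin_two_mul_add_one_cases i with ⟨i, rfl⟩ | rfl | ⟨i, rfl⟩
    · have := i.isLt
      simp only at hi
      omega
    · rw [hu, lnMat_mul_mid, hY _ _ (by simp only; omega)]
    · have hi : (⟨l + 1 + i, by omega⟩ : Fin (2*l+1)) ≠ j := by
        intro h
        rw [← h] at hj
        simp only at hj
        omega
      rw [hu, lnMat_mul_bot, if_neg hi]
      refine Finset.sum_eq_zero fun k _ => ?_
      rw [hY _ _ (by simp only; omega), if_neg, mul_zero]
      intro h
      rw [← h] at hj
      simp only at hj
      omega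
  have hbr : ∀ i j : Fin (2*l+1), l < (i : ℕ) → u i j = if i = j then 1 else 0 := by
    intro i j hi
    have h := congrFun (congrFun huJ (Fin.rev i)) j
    rw [Matrix.mul_assoc, Matrix.mul_apply, Finset.sum_eq_single (Fin.rev i), Jmat_mul_apply,
      Matrix.transpose_apply, htl _ _ (by rw [Fin.val_rev]; omega), if_pos rfl, one_mul,
      Fin.rev_rev, Jmat_apply, Fin.rev_rev] at h
    · rw [h]
      simp only [eq_comm]
    · intro s _ hs
      rw [Matrix.transpose_apply, htl _ _ (by rw [Fin.val_rev]; omega), if_neg hs, zero_mul]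
    · simp
  have hblk : ∀ i j : Fin (2*l+1), blkSiegel l (j : ℕ) ≤ blkSiegel l (i : ℕ) →
      u i j = if i = j then 1 else 0 := by
    intro i j hij
    simp only [blkSiegel] at hij
    by_cases h1 : (j : ℕ) < l
    · exact htl i j h1
    · by_cases h2 : l < (i : ℕ)
      · exact hbr i j h2
      · refine hmid i j ?_ ?_ <;> split_ifs at hij <;> omega
  refine ⟨p, u, ⟨⟨det_of_upUnip fun i j hij => hblk i j ?_, huJ⟩, hblk⟩, fun i j => ?_, ?_, ?_⟩
  · simp only [blkSiegel]
    split_ifs <;> omega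
  · rw [hpP, hP, Matrix.of_apply]
  · rw [hpP]
    exact hPu
  · rw [hu, hpP, ← Matrix.mul_assoc, ← lnMat_mul, hPQ, lnMat_one, Matrix.one_mul]

/-! ### The embedding of the even into the odd orthogonal group -/

section Embedding

lemma insTop_apply {l : ℕ} (g : Matrix (Fin (2*l)) (Fin (2*l)) F) (i' j' : Fin (2*l+1))
    (i j : Fin (2*l)) (hi : (i' : ℕ) = if (i : ℕ) < l then (i : ℕ) else (i : ℕ) + 1)
    (hj : (j' : ℕ) = if (j : ℕ) < l then (j : ℕ) else (j : ℕ) + 1) :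
    insTop F l g i' j' = g i j := by
  simp only [insTop, Matrix.of_apply]
  rw [dif_neg (by split_ifs at hi <;> omega), dif_neg (by split_ifs at hj <;> omega)]
  congr 1 <;> apply Fin.ext <;> simp only [hi, hj] <;> split_ifs <;> omega

lemma insTop_succAbove {l : ℕ} (g : Matrix (Fin (2*l)) (Fin (2*l)) F) (q : Fin (2*l+1))
    (hq : (q : ℕ) = l) (i j : Fin (2*l)) :
    insTop F l g (q.succAbove i) (q.succAbove j) = g i j := by
  have hv : ∀ k : Fin (2*l), ((q.succAbove k : Fin (2*l+1)) : ℕ) =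
      if (k : ℕ) < l then (k : ℕ) else (k : ℕ) + 1 := fun k => by
    simp only [Fin.succAbove, Fin.lt_def, Fin.val_castSucc, hq]
    split_ifs <;> rfl
  exact insTop_apply g _ _ i j (hv i) (hv j)

lemma insTop_mid_left {l : ℕ} (g : Matrix (Fin (2*l)) (Fin (2*l)) F) (q j : Fin (2*l+1))
    (hq : (q : ℕ) = l) : insTop F l g q j = if q = j then 1 else 0 := by
  simp only [insTop, Matrix.of_apply]
  rw [dif_pos hq]
  simp only [Fin.ext_iff, hq, eq_comm]

lemma insTop_mid_right {l : ℕ} (g : Matrix (Fin (2*l)) (Fin (2*l)) F) (i q : Fin (2*l+1))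
    (hq : (q : ℕ) = l) : insTop F l g i q = if i = q then 1 else 0 := by
  simp only [insTop, Matrix.of_apply, hq, Fin.ext_iff]
  split_ifs <;> rfl

lemma insTop_mul {l : ℕ} (g h : Matrix (Fin (2*l)) (Fin (2*l)) F) :
    insTop F l (g * h) = insTop F l g * insTop F l h := by
  set q : Fin (2*l+1) := ⟨l, by omega⟩ with hq
  have hq' : (q : ℕ) = l := rfl
  ext i j
  rw [Matrix.mul_apply, Fin.sum_univ_succAbove _ q, insTop_mid_right g i q hq',
    insTop_mid_left h q j hq']
  rcases Fin.eq_self_or_eq_succAbove q i with rfl | ⟨i, rfl⟩ <;>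
  rcases Fin.eq_self_or_eq_succAbove q j with hj | ⟨j, rfl⟩
  · subst hj
    simp [insTop_mid_left _ _ _ hq']
  · simp [insTop_mid_left _ _ _ hq']
  · subst hj
    simp [insTop_mid_right _ _ _ hq']
  · simp [insTop_succAbove _ _ hq', Matrix.mul_apply]

lemma insTop_transpose {l : ℕ} (g : Matrix (Fin (2*l)) (Fin (2*l)) F) :
    insTop F l gᵀ = (insTop F l g)ᵀ := by
  ext i j
  simp only [insTop, Matrix.of_apply, Matrix.transpose_apply]
  split_ifs <;> rfl

variable {l : ℕ} {ρ : F}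

section Columns

variable {o : Type*} (X : Matrix o (Fin (2*l+1)) F) (i : o)

lemma mul_Mtop_pred (hl : 2 ≤ l) :
    (X * Mtop F l ρ) i ⟨l - 1, by omega⟩ =
      2⁻¹ * (X i ⟨l, by omega⟩ + X i ⟨l + 1, by omega⟩) := by
  rw [Matrix.mul_apply, Fintype.sum_eq_add ⟨l, by omega⟩ ⟨l + 1, by omega⟩ (by rw [Ne, Fin.mk.injEq]; omega)]
  · simp only [Mtop, Matrix.of_apply]
    simp only [show ¬ (l + 2 = l + 1) by omega, show ¬ (l + 1 + 2 = l + 1) by omega,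
      show ¬ (l + 1 = l) by omega, show l - 1 + 2 = l + 1 by omega, if_true, if_false]
    ring
  · rintro k ⟨h1, h2⟩
    simp only [ne_eq, Fin.ext_iff] at h1 h2
    simp only [Mtop, Matrix.of_apply, Fin.ext_iff]
    rw [if_neg h1, if_neg h2]
    split_ifs <;> first | omega | exact mul_zero _

lemma mul_Mtop_mid (hl : 2 ≤ l) :
    (X * Mtop F l ρ) i ⟨l, by omega⟩ = X i ⟨l - 1, by omega⟩ := by
  rw [Matrix.mul_apply, Fintype.sum_eq_single ⟨l - 1, by omega⟩]
  · simp only [Mtop, Matrix.of_apply]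
    rw [if_pos (by omega), if_pos trivial, mul_one]
  · intro k h1
    simp only [ne_eq, Fin.ext_iff] at h1
    simp only [Mtop, Matrix.of_apply, Fin.ext_iff]
    split_ifs <;> first | omega | exact mul_zero _

lemma mul_Mtop_succ (hl : 2 ≤ l) :
    (X * Mtop F l ρ) i ⟨l + 1, by omega⟩ =
      (2 * (ρ/2))⁻¹ * (X i ⟨l, by omega⟩ - X i ⟨l + 1, by omega⟩) := by
  rw [Matrix.mul_apply, Fintype.sum_eq_add ⟨l, by omega⟩ ⟨l + 1, by omega⟩ (by rw [Ne, Fin.mk.injEq]; omega)]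
  · simp only [Mtop, Matrix.of_apply]
    simp only [show ¬ (l + 2 = l + 1) by omega, show ¬ (l + 1 + 2 = l + 1) by omega,
      show ¬ (l + 1 = l) by omega, if_true, if_false]
    ring
  · rintro k ⟨h1, h2⟩
    simp only [ne_eq, Fin.ext_iff] at h1 h2
    simp only [Mtop, Matrix.of_apply, Fin.ext_iff]
    rw [if_neg h1, if_neg h2]
    split_ifs <;> first | omega | exact mul_zero _

lemma mul_Mtop_of_ne (j : Fin (2*l+1)) (hj : (j : ℕ) + 1 < l ∨ l + 1 < j) :
    (X * Mtop F l ρ) i j = X i j := by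
  rw [Matrix.mul_apply, Fintype.sum_eq_single j]
  · simp only [Mtop, Matrix.of_apply]
    rw [if_neg (by omega), if_neg (by omega), if_neg (by omega), if_pos trivial, mul_one]
  · intro k h1
    simp only [ne_eq, Fin.ext_iff] at h1
    simp only [Mtop, Matrix.of_apply, Fin.ext_iff]
    split_ifs <;> first | omega | exact mul_zero _

end Columns

/-- The inverse of the conjugating matrix `Mtop`. -/
def MtopInv (F : Type) [Field F] (l : ℕ) (ρ : F) : Matrix (Fin (2*l+1)) (Fin (2*l+1)) F :=
  Matrix.of fun i j =>
    if (i : ℕ) + 1 = l then (if (j : ℕ) = l ∨ (j : ℕ) = l + 1 then 1 else 0)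
    else if (i : ℕ) = l then (if (j : ℕ) + 1 = l then 1 else 0)
    else if (i : ℕ) = l + 1 then
      (if (j : ℕ) = l then ρ/2 else if (j : ℕ) = l + 1 then -(ρ/2) else 0)
    else if i = j then 1 else 0

section Rows

variable {o : Type*} (X : Matrix (Fin (2*l+1)) o F) (j : o)

lemma MtopInv_mul_pred (hl : 2 ≤ l) :
    (MtopInv F l ρ * X) ⟨l - 1, by omega⟩ j =
      X ⟨l, by omega⟩ j + X ⟨l + 1, by omega⟩ j := by
  rw [Matrix.mul_apply, Fintype.sum_eq_add ⟨l, by omega⟩ ⟨l + 1, by omega⟩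
    (by rw [Ne, Fin.mk.injEq]; omega)]
  · simp only [MtopInv, Matrix.of_apply]
    have e : l - 1 + 1 = l := by omega
    rw [if_pos e, if_pos (Or.inl trivial), if_pos e, if_pos (Or.inr trivial), one_mul, one_mul]
  · rintro k ⟨h1, h2⟩
    simp only [ne_eq, Fin.ext_iff] at h1 h2
    simp only [MtopInv, Matrix.of_apply, Fin.ext_iff]
    split_ifs <;> first | omega | exact zero_mul _

lemma MtopInv_mul_mid (hl : 2 ≤ l) :
    (MtopInv F l ρ * X) ⟨l, by omega⟩ j = X ⟨l - 1, by omega⟩ j := by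
  rw [Matrix.mul_apply, Fintype.sum_eq_single ⟨l - 1, by omega⟩]
  · simp only [MtopInv, Matrix.of_apply]
    rw [if_neg (by omega), if_pos trivial, if_pos (by omega), one_mul]
  · intro k h1
    simp only [ne_eq, Fin.ext_iff] at h1
    simp only [MtopInv, Matrix.of_apply, Fin.ext_iff]
    split_ifs <;> first | omega | exact zero_mul _

lemma MtopInv_mul_succ (hl : 2 ≤ l) :
    (MtopInv F l ρ * X) ⟨l + 1, by omega⟩ j =
      (ρ/2) * (X ⟨l, by omega⟩ j - X ⟨l + 1, by omega⟩ j) := by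
  rw [Matrix.mul_apply, Fintype.sum_eq_add ⟨l, by omega⟩ ⟨l + 1, by omega⟩
    (by rw [Ne, Fin.mk.injEq]; omega)]
  · simp only [MtopInv, Matrix.of_apply]
    rw [if_neg (by omega), if_neg (by omega), if_pos trivial, if_pos trivial, if_neg (by omega),
      if_neg (by omega), if_pos trivial, if_neg (by omega), if_pos trivial]
    ring
  · rintro k ⟨h1, h2⟩
    simp only [ne_eq, Fin.ext_iff] at h1 h2
    simp only [MtopInv, Matrix.of_apply, Fin.ext_iff]
    split_ifs <;> first | omega | exact zero_mul _

lemma MtopInv_mul_of_ne (i : Fin (2*l+1)) (hi : (i : ℕ) + 1 < l ∨ l + 1 < i) :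
    (MtopInv F l ρ * X) i j = X i j := by
  rw [Matrix.mul_apply, Fintype.sum_eq_single i]
  · simp only [MtopInv, Matrix.of_apply]
    rw [if_neg (by omega), if_neg (by omega), if_neg (by omega), if_pos trivial, one_mul]
  · intro k h1
    simp only [ne_eq, Fin.ext_iff] at h1
    simp only [MtopInv, Matrix.of_apply, Fin.ext_iff]
    split_ifs <;> first | omega | exact zero_mul _

end Rows

lemma fin_mid_cases (hl : 2 ≤ l) (i : Fin (2*l+1)) :
    i = ⟨l - 1, by omega⟩ ∨ i = ⟨l, by omega⟩ ∨ i = ⟨l + 1, by omega⟩ ∨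
      ((i : ℕ) + 1 < l ∨ l + 1 < i) := by
  simp only [Fin.ext_iff]
  omega

lemma MtopInv_mul_Mtop (hl : 2 ≤ l) (hρ : ρ ≠ 0) (h2 : (2 : F) ≠ 0) :
    MtopInv F l ρ * Mtop F l ρ = 1 := by
  ext i j
  rcases fin_mid_cases hl j with rfl | rfl | rfl | hj
  · rw [mul_Mtop_pred _ _ hl]
    simp only [MtopInv, Matrix.of_apply, Matrix.one_apply, Fin.ext_iff, or_true, true_or, if_true]
    split_ifs <;> first | omega | (field_simp; ring)
  · rw [mul_Mtop_mid _ _ hl]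
    simp only [MtopInv, Matrix.of_apply, Matrix.one_apply, Fin.ext_iff]
    split_ifs <;> first | omega | rfl
  · rw [mul_Mtop_succ _ _ hl]
    simp only [MtopInv, Matrix.of_apply, Matrix.one_apply, Fin.ext_iff, or_true, true_or, if_true]
    split_ifs <;> first | omega | (field_simp; ring)
  · rw [mul_Mtop_of_ne _ _ _ hj]
    simp only [MtopInv, Matrix.of_apply, Matrix.one_apply, Fin.ext_iff]
    split_ifs <;> first | omega | rfl

end Embedding

section EmbeddingIsometry

variable {l : ℕ} {ρ : F}

lemma embTop_eq (hl : 2 ≤ l) (hρ : ρ ≠ 0) (h2 : (2 : F) ≠ 0)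
    (g : Matrix (Fin (2*l)) (Fin (2*l)) F) :
    embTop F l ρ g = MtopInv F l ρ * (insTop F l g * Mtop F l ρ) := by
  rw [embTop, Matrix.inv_eq_left_inv (MtopInv_mul_Mtop hl hρ h2), Matrix.mul_assoc]

/-- The Gram matrix carried to `Jmat` by the change of basis `Mtop`. -/
def Ktop (F : Type) [Field F] (l : ℕ) (ρ : F) : Matrix (Fin (2*l+1)) (Fin (2*l+1)) F :=
  insTop F l (Jrho F l ρ) * Matrix.diagonal fun i : Fin (2*l+1) => if (i : ℕ) = l then ρ else 1

lemma Ktop_apply (hl : 2 ≤ l) (i j : Fin (2*l+1)) :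
    Ktop F l ρ i j =
      if (i : ℕ) + 1 = l then (if (j : ℕ) + 1 = l then 1 else 0)
      else if (i : ℕ) = l then (if (j : ℕ) = l then ρ else 0)
      else if (i : ℕ) = l + 1 then (if (j : ℕ) = l + 1 then -ρ else 0)
      else (if j = Fin.rev i then 1 else 0) := by
  have := i.isLt
  have := j.isLt
  simp only [Ktop, Matrix.mul_diagonal, insTop, Matrix.of_apply, Jrho_apply hl, Fin.ext_iff,
    Fin.val_rev]
  split_ifs <;> first | omega | simp

set_option maxHeartbeats 1000000 in
lemma Ktop_mul_Mtop (hl : 2 ≤ l) (hρ : ρ ≠ 0) (h2 : (2 : F) ≠ 0) :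
    Ktop F l ρ * Mtop F l ρ = (MtopInv F l ρ)ᵀ * Jmat F (2*l+1) := by
  ext i j
  have := i.isLt
  rw [mul_Jmat_apply, Matrix.transpose_apply]
  rcases fin_mid_cases hl j with rfl | rfl | rfl | hj
  · rw [mul_Mtop_pred _ _ hl]
    simp only [MtopInv, Ktop_apply hl, Matrix.of_apply, Fin.ext_iff, Fin.val_rev]
    split_ifs <;> first | omega | simp [div_eq_inv_mul]
  · rw [mul_Mtop_mid _ _ hl]
    simp only [MtopInv, Ktop_apply hl, Matrix.of_apply, Fin.ext_iff, Fin.val_rev]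
    split_ifs <;> first | omega | rfl
  · rw [mul_Mtop_succ _ _ hl, mul_div_cancel₀ ρ h2]
    simp only [MtopInv, Ktop_apply hl, Matrix.of_apply, Fin.ext_iff, Fin.val_rev]
    split_ifs <;> first | omega | simp [hρ]
  · rw [mul_Mtop_of_ne _ _ _ hj]
    have := j.isLt
    simp only [MtopInv, Ktop_apply hl, Matrix.of_apply, Fin.ext_iff, Fin.val_rev]
    split_ifs <;> first | omega | rfl

lemma insTop_mul_diagonal (g : Matrix (Fin (2*l)) (Fin (2*l)) F) :
    insTop F l g * (Matrix.diagonal fun i : Fin (2*l+1) => if (i : ℕ) = l then ρ else 1) =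
      (Matrix.diagonal fun i : Fin (2*l+1) => if (i : ℕ) = l then ρ else 1) * insTop F l g := by
  ext i j
  simp only [Matrix.mul_diagonal, Matrix.diagonal_mul, insTop, Matrix.of_apply]
  split_ifs <;> simp

lemma embTop_form (hl : 2 ≤ l) (hρ : ρ ≠ 0) (h2 : (2 : F) ≠ 0)
    {g : Matrix (Fin (2*l)) (Fin (2*l)) F} (hg : gᵀ * Jrho F l ρ * g = Jrho F l ρ) :
    (embTop F l ρ g)ᵀ * Jmat F (2*l+1) * embTop F l ρ g = Jmat F (2*l+1) := by
  have hinv := MtopInv_mul_Mtop hl hρ h2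
  have hinv' : Mtop F l ρ * MtopInv F l ρ = 1 := mul_eq_one_comm.mp hinv
  have hK : (insTop F l g)ᵀ * Ktop F l ρ * insTop F l g = Ktop F l ρ := by
    rw [Ktop, Matrix.mul_assoc, Matrix.mul_assoc, ← insTop_mul_diagonal, ← insTop_transpose,
      ← Matrix.mul_assoc, ← Matrix.mul_assoc, ← insTop_mul, ← insTop_mul, hg]
  have hJ : (MtopInv F l ρ)ᵀ * Jmat F (2*l+1) * MtopInv F l ρ = Ktop F l ρ := by
    rw [← Ktop_mul_Mtop hl hρ h2, Matrix.mul_assoc, hinv', Matrix.mul_one]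
  calc _ = (Mtop F l ρ)ᵀ * ((insTop F l g)ᵀ * ((MtopInv F l ρ)ᵀ * Jmat F (2*l+1) * MtopInv F l ρ)
          * insTop F l g) * Mtop F l ρ := by
        rw [embTop_eq hl hρ h2]
        simp only [Matrix.transpose_mul, Matrix.mul_assoc]
    _ = (MtopInv F l ρ * Mtop F l ρ)ᵀ * Jmat F (2*l+1) := by
        rw [hJ, hK, Matrix.mul_assoc, Ktop_mul_Mtop hl hρ h2, Matrix.transpose_mul,
          Matrix.mul_assoc]
    _ = _ := by rw [hinv, Matrix.transpose_one, Matrix.one_mul]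

section Entries

variable (g : Matrix (Fin (2*l)) (Fin (2*l)) F)

lemma embTop_apply_mid (hl : 2 ≤ l) (hρ : ρ ≠ 0) (h2 : (2 : F) ≠ 0) (j : Fin (2*l+1)) :
    embTop F l ρ g ⟨l, by omega⟩ j = (insTop F l g * Mtop F l ρ) ⟨l - 1, by omega⟩ j := by
  rw [embTop_eq hl hρ h2, MtopInv_mul_mid _ _ hl]

lemma embTop_apply_pred (hl : 2 ≤ l) (hρ : ρ ≠ 0) (h2 : (2 : F) ≠ 0) (j : Fin (2*l+1)) :
    embTop F l ρ g ⟨l - 1, by omega⟩ j =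
      (insTop F l g * Mtop F l ρ) ⟨l, by omega⟩ j +
        (insTop F l g * Mtop F l ρ) ⟨l + 1, by omega⟩ j := by
  rw [embTop_eq hl hρ h2, MtopInv_mul_pred _ _ hl]

lemma embTop_apply_succ (hl : 2 ≤ l) (hρ : ρ ≠ 0) (h2 : (2 : F) ≠ 0) (j : Fin (2*l+1)) :
    embTop F l ρ g ⟨l + 1, by omega⟩ j =
      (ρ/2) * ((insTop F l g * Mtop F l ρ) ⟨l, by omega⟩ j -
        (insTop F l g * Mtop F l ρ) ⟨l + 1, by omega⟩ j) := by
  rw [embTop_eq hl hρ h2, MtopInv_mul_succ _ _ hl]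

lemma embTop_apply_of_ne (hl : 2 ≤ l) (hρ : ρ ≠ 0) (h2 : (2 : F) ≠ 0) (i j : Fin (2*l+1))
    (hi : (i : ℕ) + 1 < l ∨ l + 1 < i) :
    embTop F l ρ g i j = (insTop F l g * Mtop F l ρ) i j := by
  rw [embTop_eq hl hρ h2, MtopInv_mul_of_ne _ _ _ hi]

end Entries

lemma isMirabolic_of_embTop (hl : 2 ≤ l) (hρ : ρ ≠ 0) (h2 : (2 : F) ≠ 0)
    {g : Matrix (Fin (2*l)) (Fin (2*l)) F}
    (hg : ∀ i j : Fin (2*l+1), l ≤ (i : ℕ) → (j : ℕ) < l → embTop F l ρ g i j = 0) :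
    IsMirabolic l g := by
  have h2' : (2 : F)⁻¹ ≠ 0 := inv_ne_zero h2
  have hρ2 : ρ/2 ≠ 0 := div_ne_zero hρ h2
  have hmid : ∀ q : Fin (2*l+1), insTop F l g q ⟨l, by omega⟩ = if (q : ℕ) = l then 1 else 0 :=
    fun q => by
      rw [insTop_mid_right _ _ _ rfl]
      simp [Fin.ext_iff]
  have hmid' : ∀ q : Fin (2*l+1), insTop F l g ⟨l, by omega⟩ q = if (q : ℕ) = l then 1 else 0 :=
    fun q => by
      rw [insTop_mid_left _ _ _ rfl]
      simp [Fin.ext_iff, eq_comm]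
  intro i j hi hj
  have hilt := i.isLt
  have hjlt := j.isLt
  rcases hj with hj | hj
  · have hR : ∀ q : Fin (2*l+1), (insTop F l g * Mtop F l ρ) q ⟨j, by omega⟩ =
        insTop F l g q ⟨j, by omega⟩ := fun q => mul_Mtop_of_ne _ _ _ (Or.inl (by simp only; omega))
    rw [if_neg (fun h => by rw [h] at hi; omega)]
    rcases (by omega : (i : ℕ) = l - 1 ∨ (i : ℕ) = l ∨ l + 1 ≤ (i : ℕ)) with h | h | h
    · have e := hg ⟨l, by omega⟩ ⟨j, by omega⟩ le_rfl (by simp only; omega)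
      rw [embTop_apply_mid g hl hρ h2, hR] at e
      rw [← e]
      exact (insTop_apply g _ _ i j (by simp only; split_ifs <;> omega)
        (by simp only; split_ifs <;> omega)).symm
    · have e := hg ⟨l + 1, by omega⟩ ⟨j, by omega⟩ (by simp only; omega) (by simp only; omega)
      rw [embTop_apply_succ g hl hρ h2, hR, hR, hmid', if_neg (by simp only; omega), mul_eq_zero,
        or_iff_right hρ2, zero_sub, neg_eq_zero] at e
      rw [← e]
      exact (insTop_apply g _ _ i j (by simp only; split_ifs <;> omega)
        (by simp only; split_ifs <;> omega)).symm
    · have e := hg ⟨i + 1, by omega⟩ ⟨j, by omega⟩ (by simp only; omega) (by simp only; omega)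
      rw [embTop_apply_of_ne g hl hρ h2 _ _ (Or.inr (by simp only; omega)), hR] at e
      rw [← e]
      exact (insTop_apply g _ _ i j (by simp only; split_ifs <;> omega)
        (by simp only; split_ifs <;> omega)).symm
  · rcases (by omega : (i : ℕ) = l - 1 ∨ (i : ℕ) = l ∨ l + 1 ≤ (i : ℕ)) with h | h | h
    · have e := hg ⟨l, by omega⟩ ⟨l - 1, by omega⟩ le_rfl (by simp only; omega)
      rw [embTop_apply_mid g hl hρ h2, mul_Mtop_pred _ _ hl, hmid, if_neg (by simp only; omega),
        zero_add, mul_eq_zero, or_iff_right h2'] at e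
      rw [if_neg (fun h => by rw [h] at hi; omega), ← e]
      exact (insTop_apply g _ _ i j (by simp only; split_ifs <;> omega)
        (by simp only; split_ifs <;> omega)).symm
    · have e := hg ⟨l + 1, by omega⟩ ⟨l - 1, by omega⟩ (by simp only; omega) (by simp only; omega)
      rw [embTop_apply_succ g hl hρ h2, mul_Mtop_pred _ _ hl, mul_Mtop_pred _ _ hl, hmid, hmid,
        hmid', if_pos rfl, if_neg (by simp only; omega), mul_eq_zero,
        or_iff_right hρ2, ← mul_sub, mul_eq_zero, or_iff_right h2', zero_add, add_zero,
        sub_eq_zero] at e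
      rw [if_pos (Fin.ext (by omega)), e]
      exact (insTop_apply g _ _ i j (by simp only; split_ifs <;> omega)
        (by simp only; split_ifs <;> omega)).symm
    · have e := hg ⟨i + 1, by omega⟩ ⟨l - 1, by omega⟩ (by simp only; omega) (by simp only; omega)
      rw [embTop_apply_of_ne g hl hρ h2 _ _ (Or.inr (by simp only; omega)), mul_Mtop_pred _ _ hl,
        hmid, if_neg (by simp only; omega), zero_add, mul_eq_zero, or_iff_right h2'] at e
      rw [if_neg (fun h' => by rw [h'] at h; omega), ← e]
      exact (insTop_apply g _ _ i j (by simp only; split_ifs <;> omega)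
        (by simp only; split_ifs <;> omega)).symm

lemma insTop_upUnip {g : Matrix (Fin (2*l)) (Fin (2*l)) F} (hg : upUnip F g) :
    upUnip F (insTop F l g) := by
  intro i j hij
  by_cases hi : (i : ℕ) = l
  · exact insTop_mid_left g i j hi
  by_cases hj : (j : ℕ) = l
  · exact insTop_mid_right g i j hj
  have hilt := i.isLt
  have hjlt := j.isLt
  have hex : ∀ k : Fin (2*l+1), (k : ℕ) ≠ l → ∃ a : Fin (2*l),
      (k : ℕ) = if (a : ℕ) < l then (a : ℕ) else (a : ℕ) + 1 := fun k hk => by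
    rcases lt_or_gt_of_ne hk with h | h
    · exact ⟨⟨k, by omega⟩, by simp only; rw [if_pos h]⟩
    · exact ⟨⟨k - 1, by omega⟩, by simp only; rw [if_neg (by omega)]; omega⟩
  obtain ⟨a, ha⟩ := hex i hi
  obtain ⟨b, hb⟩ := hex j hj
  rw [insTop_apply g i j a b ha hb, hg a b (by split_ifs at ha hb <;> omega)]
  have e : a = b ↔ i = j := by
    simp only [Fin.ext_iff]
    split_ifs at ha hb <;> omega
  simp only [e]

lemma embTop_upUnip (hl : 2 ≤ l) (hρ : ρ ≠ 0) (h2 : (2 : F) ≠ 0)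
    {g : Matrix (Fin (2*l)) (Fin (2*l)) F} (hg : upUnip F g)
    (h0 : ∀ i j : Fin (2*l), (i : ℕ) = l - 1 → (j : ℕ) = l → g i j = 0) :
    upUnip F (embTop F l ρ g) := by
  have hT := insTop_upUnip hg
  have hT0 : insTop F l g ⟨l - 1, by omega⟩ ⟨l + 1, by omega⟩ = 0 := by
    rw [insTop_apply g _ _ ⟨l - 1, by omega⟩ ⟨l, by omega⟩ (by simp only; split_ifs <;> omega)
      (by simp only; split_ifs <;> omega)]
    exact h0 _ _ rfl rfl
  have hmid : ∀ q : Fin (2*l+1), insTop F l g q ⟨l, by omega⟩ = if (q : ℕ) = l then 1 else 0 :=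
    fun q => by
      rw [insTop_mid_right _ _ _ rfl]
      simp [Fin.ext_iff]
  have hmid' : ∀ q : Fin (2*l+1), insTop F l g ⟨l, by omega⟩ q = if (q : ℕ) = l then 1 else 0 :=
    fun q => by
      rw [insTop_mid_left _ _ _ rfl]
      simp [Fin.ext_iff, eq_comm]
  have hlow : ∀ (i : Fin (2*l+1)) (j : Fin (2*l+1)), j < i → insTop F l g i j = 0 := fun i j h => by
    rw [hT i j h.le, if_neg h.ne']
  have hdiag : ∀ i : Fin (2*l+1), insTop F l g i i = 1 := fun i => by
    rw [hT i i le_rfl, if_pos rfl]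
  have t1 := hdiag ⟨l, by omega⟩
  have t2 := hmid' ⟨l + 1, by omega⟩
  rw [if_neg (by simp only; omega)] at t2
  have t3 := hlow ⟨l + 1, by omega⟩ ⟨l, by omega⟩ (by simp [Fin.lt_def])
  have t4 := hdiag ⟨l + 1, by omega⟩
  intro i j hij
  rcases fin_mid_cases hl i with rfl | rfl | rfl | hi
  · rcases fin_mid_cases hl j with rfl | rfl | rfl | hj
    · rw [embTop_apply_pred g hl hρ h2, mul_Mtop_pred _ _ hl, mul_Mtop_pred _ _ hl, t1, t2, t3, t4,
        if_pos rfl]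
      field_simp
      norm_num
    · simp only at hij
      omega
    · simp only at hij
      omega
    · simp only at hij
      rw [embTop_apply_pred g hl hρ h2, mul_Mtop_of_ne _ _ _ hj, mul_Mtop_of_ne _ _ _ hj,
        hlow _ _ (by rw [Fin.lt_def]; simp only; omega),
        hlow _ _ (by rw [Fin.lt_def]; simp only; omega),
        if_neg (fun h => by rw [← h] at hj; simp only at hj; omega), add_zero]
  · rcases fin_mid_cases hl j with rfl | rfl | rfl | hj
    · rw [embTop_apply_mid g hl hρ h2, mul_Mtop_pred _ _ hl, hT0, hmid,
        if_neg (by simp only; omega), if_neg (by rw [Fin.mk.injEq]; omega), add_zero, mul_zero]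
    · rw [embTop_apply_mid g hl hρ h2, mul_Mtop_mid _ _ hl, hdiag, if_pos rfl]
    · simp only at hij
      omega
    · simp only at hij
      rw [embTop_apply_mid g hl hρ h2, mul_Mtop_of_ne _ _ _ hj,
        hlow _ _ (by rw [Fin.lt_def]; simp only; omega),
        if_neg (fun h => by rw [← h] at hj; simp only at hj; omega)]
  · rcases fin_mid_cases hl j with rfl | rfl | rfl | hj
    · rw [embTop_apply_succ g hl hρ h2, mul_Mtop_pred _ _ hl, mul_Mtop_pred _ _ hl, t1, t2, t3, t4,
        if_neg (by rw [Fin.mk.injEq]; omega)]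
      ring
    · rw [embTop_apply_succ g hl hρ h2, mul_Mtop_mid _ _ hl, mul_Mtop_mid _ _ hl,
        hlow _ _ (by rw [Fin.lt_def]; simp only; omega),
        hlow _ _ (by rw [Fin.lt_def]; simp only; omega),
        if_neg (by rw [Fin.mk.injEq]; omega), sub_zero, mul_zero]
    · rw [embTop_apply_succ g hl hρ h2, mul_Mtop_succ _ _ hl, mul_Mtop_succ _ _ hl, t1, t2, t3, t4,
        if_pos rfl]
      field_simp
      norm_num
    · simp only at hij
      rw [embTop_apply_succ g hl hρ h2, mul_Mtop_of_ne _ _ _ hj, mul_Mtop_of_ne _ _ _ hj,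
        hlow _ _ (by rw [Fin.lt_def]; simp only; omega),
        hlow _ _ (by rw [Fin.lt_def]; simp only; omega),
        if_neg (fun h => by rw [← h] at hj; simp only at hj; omega), sub_zero, mul_zero]
  · rw [embTop_apply_of_ne g hl hρ h2 _ _ hi]
    rcases fin_mid_cases hl j with rfl | rfl | rfl | hj
    · simp only at hij
      rw [mul_Mtop_pred _ _ hl, hlow _ _ (by rw [Fin.lt_def]; simp only; omega),
        hlow _ _ (by rw [Fin.lt_def]; simp only; omega),
        if_neg (fun h => by rw [h] at hi; simp only at hi; omega), add_zero, mul_zero]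
    · simp only at hij
      rw [mul_Mtop_mid _ _ hl, hlow _ _ (by rw [Fin.lt_def]; simp only; omega),
        if_neg (fun h => by rw [h] at hi; simp only at hi; omega)]
    · simp only at hij
      rw [mul_Mtop_succ _ _ hl, hlow _ _ (by rw [Fin.lt_def]; simp only; omega),
        hlow _ _ (by rw [Fin.lt_def]; simp only; omega),
        if_neg (fun h => by rw [h] at hi; simp only at hi; omega), sub_zero, mul_zero]
    · rw [mul_Mtop_of_ne _ _ _ hj]
      exact hT i j hij

/-- The exponents of the two generic characters agree along the embedding. -/
lemma psiU_eq_glUSum (hl : 2 ≤ l) (hρ : ρ ≠ 0) (h2 : (2 : F) ≠ 0) (ψ : AddChar F ℂ)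
    (g : Matrix (Fin (2*l)) (Fin (2*l)) F) (p : Matrix (Fin l) (Fin l) F)
    (hp : ∀ i j : Fin l, p i j = embTop F l ρ g ⟨i, by omega⟩ ⟨j, by omega⟩) :
    psiU F l ψ g = ψ (glUSum F l p) := by
  rw [psiU, glUSum, sum_fin_two_mul]
  congr 1
  refine (congrArg₂ (· + ·) ?_ ?_).trans (add_zero _)
  swap
  · refine Finset.sum_eq_zero fun i _ => Finset.sum_eq_zero fun j _ => ?_
    rw [if_neg (by simp only; omega), if_neg (by simp only; omega)]
  refine Finset.sum_congr rfl fun i _ => ?_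
  have hilt := i.isLt
  rcases (by omega : (i : ℕ) + 1 = l ∨ (i : ℕ) + 2 = l ∨ (i : ℕ) + 3 ≤ l) with hi | hi | hi
  · rw [Finset.sum_eq_zero fun j _ => ?_, Finset.sum_eq_zero fun j _ => ?_]
    · have := j.isLt
      rw [if_neg (by omega)]
    · rw [if_neg (by simp only; omega), if_neg (by simp only; omega)]
  · rw [Fintype.sum_eq_single ⟨l, by omega⟩, Fintype.sum_eq_single ⟨i + 1, by omega⟩,
      if_neg (by simp only; omega), if_pos ⟨hi, rfl⟩, if_pos rfl, hp,
      embTop_apply_of_ne g hl hρ h2 _ _ (Or.inl (by simp only; omega))]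
    · have e : (⟨i + 1, by omega⟩ : Fin (2*l+1)) = ⟨l - 1, by omega⟩ := Fin.ext (by simp only; omega)
      simp only [e]
      rw [mul_Mtop_pred _ _ hl, insTop_mid_right _ _ _ rfl,
        if_neg (by rw [Fin.mk.injEq]; omega), zero_add,
        insTop_apply g _ _ ⟨i, by omega⟩ ⟨l, by omega⟩ (by simp only; split_ifs; omega)
          (by simp only; split_ifs <;> omega)]
    · intro j hj
      simp only [ne_eq, Fin.ext_iff] at hj
      rw [if_neg hj]
    · intro j hj
      simp only [ne_eq, Fin.ext_iff] at hj
      rw [if_neg (by simp only; omega), if_neg (fun h => hj h.2)]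
  · rw [Fintype.sum_eq_single ⟨i + 1, by omega⟩, Fintype.sum_eq_single ⟨i + 1, by omega⟩,
      if_pos ⟨rfl, hi⟩, if_pos rfl, hp,
      embTop_apply_of_ne g hl hρ h2 _ _ (Or.inl (by simp only; omega)),
      mul_Mtop_of_ne _ _ _ (Or.inl (by simp only; omega)),
      insTop_apply g _ _ ⟨i, by omega⟩ ⟨i + 1, by omega⟩ (by simp only; split_ifs; omega)
          (by simp only; split_ifs <;> omega)]
    · intro j hj
      simp only [ne_eq, Fin.ext_iff] at hj
      rw [if_neg hj]
    · intro j hj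
      simp only [ne_eq, Fin.ext_iff] at hj
      rw [if_neg (fun h => hj h.1), if_neg (by simp only; omega)]

end EmbeddingIsometry

section ZetaIntegral

variable {l : ℕ} {ρ : F}

/-- The scalar matrix `c·I_l` as an element of `GL_l`. -/
def glScalar (l : ℕ) (c : Fˣ) : GL (Fin l) F where
  val := (c : F) • 1
  inv := ((c⁻¹ : Fˣ) : F) • 1
  val_inv := by simp [smul_smul]
  inv_val := by simp [smul_smul]

lemma glScalar_mul_comm (c : Fˣ) (p : GL (Fin l) F) : glScalar l c * p = p * glScalar l c := by
  ext1
  simp [glScalar]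

lemma wllMat_mul_apply (Y : Matrix (Fin (2*l+1)) (Fin (2*l+1)) F) (i j : Fin (2*l+1)) :
    (wllMat F l ρ * Y) i j =
      (if (i : ℕ) < l then ρ/2 else if (i : ℕ) = l then 1 else (ρ/2)⁻¹) * Y i j := by
  rw [Matrix.mul_apply, Fintype.sum_eq_single i fun k hk => ?_]
  · rw [wllMat, Matrix.of_apply, if_pos rfl]
  · rw [wllMat, Matrix.of_apply, if_neg hk.symm, zero_mul]

lemma one_mem_USet : (1 : SO2l F l ρ) ∈ USet F l ρ := fun i j _ => by
  simp [mat, Matrix.one_apply]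

section Whittaker

variable {V : Type*} [AddCommGroup V] [Module ℂ V] {π : Representation ℂ (SO2l F l ρ) V}
  {Γ : V →ₗ[ℂ] ℂ} {v₀ : V} {Wτ : Type*} [AddCommGroup Wτ] [Module ℂ Wτ]
  {τ : Representation ℂ (GL (Fin l) F) Wτ} {Λ : Wτ →ₗ[ℂ] ℂ} {ψ : AddChar F ℂ}

lemma fvFun_wllMat (hρ2 : ρ/2 ≠ 0) (v : Wτ) :
    fvFun F l τ Λ v (wllMat F l ρ) 1 = Λ (τ (glScalar l (Units.mk0 (ρ/2) hρ2)) v) := by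
  have h := fvFun_lnMat_mul τ Λ v (glScalar l (Units.mk0 (ρ/2) hρ2)) (one_mem_VnSet l)
  rw [Matrix.mul_one] at h
  rw [← h, wllMat_eq_lnMat]
  rfl

lemma Bessel_mul_fvFun_of_mem (hl : 2 ≤ l) (hρ : ρ ≠ 0) (h2 : (2 : F) ≠ 0)
    (hv₀ : IsWhitVec F l ρ ψ π Γ v₀) (hΛ : IsGenericGLinv F l ψ τ Λ) (v : Wτ)
    {g : SO2l F l ρ} (hg : g ∈ USet F l ρ) :
    Bessel F l ρ π Γ v₀ g * fvFun F l τ Λ v (wllMat F l ρ * embTop F l ρ (mat F g)) 1 =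
      fvFun F l τ Λ v (wllMat F l ρ) 1 := by
  have hρ2 : ρ/2 ≠ 0 := div_ne_zero hρ h2
  obtain ⟨p, u, hu, hp, hpu, hY⟩ := exists_lnMat_mul
    (embTop_upUnip hl hρ h2 hg (USet.mid_eq_zero hl hg)) (embTop_form hl hρ h2 g.2.2)
  set s := glScalar l (Units.mk0 (ρ/2) hρ2) with hs
  have hw : wllMat F l ρ * embTop F l ρ (mat F g) =
      lnMat F l ((s * p : GL (Fin l) F) : Matrix (Fin l) (Fin l) F) * u := by
    rw [hY, wllMat_eq_lnMat, Units.val_mul, lnMat_mul, Matrix.mul_assoc]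
    rfl
  rw [hw, fvFun_lnMat_mul _ _ _ _ hu, fvFun_wllMat hρ2, ← hs, glScalar_mul_comm, ← hs, map_mul,
    Module.End.mul_apply, hΛ.2 p hpu, Bessel, hv₀.2 g hg, map_smul, smul_eq_mul,
    mul_div_cancel_right₀ _ hv₀.1, psiU_eq_glUSum hl hρ h2 ψ _ _ hp, ← mul_assoc,
    ← AddChar.map_add_eq_mul, add_neg_cancel, AddChar.map_zero_eq_one, one_mul]

lemma Bessel_mul_fvFun_of_notMem (hl : 2 ≤ l) (hρ : ρ ≠ 0) (h2 : (2 : F) ≠ 0) (hψ : ψ ≠ 1)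
    (hΓ : IsWhittaker F l ρ ψ π Γ) (hv₀ : IsWhitVec F l ρ ψ π Γ v₀) (v : Wτ)
    {g : SO2l F l ρ} (hg : g ∉ USet F l ρ) :
    Bessel F l ρ π Γ v₀ g * fvFun F l τ Λ v (wllMat F l ρ * embTop F l ρ (mat F g)) 1 = 0 := by
  by_contra hne
  obtain ⟨hB, hf⟩ := mul_ne_zero_iff.mp hne
  refine hg (IsMirabolic.mem_USet hl hρ h2 hψ hΓ hv₀
    (isMirabolic_of_embTop hl hρ h2 fun i j hi hj => ?_) fun h => hB ?_)
  · have h := fvFun_support τ Λ v hf i j hi hj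
    rw [wllMat_mul_apply, if_neg hi.not_gt] at h
    refine (mul_eq_zero.mp h).resolve_left ?_
    split_ifs
    exacts [one_ne_zero, inv_ne_zero (div_ne_zero hρ h2)]
  · rw [Bessel, h, zero_div]

lemma Zeta_Bessel_fvFun (hl : 2 ≤ l) (hρ : ρ ≠ 0) (h2 : (2 : F) ≠ 0) (hψ : ψ ≠ 1)
    (hΓ : IsWhittaker F l ρ ψ π Γ) (hv₀ : IsWhitVec F l ρ ψ π Γ v₀)
    (hΛ : IsGenericGLinv F l ψ τ Λ) (v : Wτ) :
    Zeta F l ρ l (Bessel F l ρ π Γ v₀) (fvFun F l τ Λ v) =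
      fvFun F l τ Λ v (wllMat F l ρ) 1 := by
  classical
  have := Fintype.ofFinite (SO2l F l ρ)
  have hU : (Nat.card (USet F l ρ) : ℂ) ≠ 0 := by
    have : Nonempty (USet F l ρ) := ⟨⟨1, one_mem_USet⟩⟩
    exact Nat.cast_ne_zero.mpr Nat.card_pos.ne'
  rw [Zeta, if_neg (lt_irrefl l), dif_pos rfl, cast_eq, ZetaTop, finsum_eq_sum_of_fintype,
    Finset.sum_congr rfl fun g _ => show _ = if g ∈ USet F l ρ then
      fvFun F l τ Λ v (wllMat F l ρ) 1 else 0 from ?_, ← Finset.sum_filter, Finset.sum_const,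
    nsmul_eq_mul, ← Nat.subtype_card _ (fun _ => by simp; rfl), inv_mul_cancel_left₀ hU]
  split_ifs with hg
  · exact Bessel_mul_fvFun_of_mem hl hρ h2 hv₀ hΛ v hg
  · exact Bessel_mul_fvFun_of_notMem hl hρ h2 hψ hΓ hv₀ v hg

end Whittaker

end ZetaIntegral

lemma two_ne_zero_of_card {p r : ℕ} (hp : p.Prime) (hp2 : p ≠ 2)
    (hcard : Fintype.card F = p ^ r) : (2 : F) ≠ 0 := by
  intro h
  have h0 : ((p ^ r : ℕ) : F) = 0 := by rw [← hcard, FiniteField.cast_card_eq_zero]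
  have hodd : Odd (p ^ r) := (hp.odd_of_ne_two hp2).pow
  obtain ⟨k, hk⟩ := hodd
  rw [hk] at h0
  push_cast at h0
  rw [h, zero_mul, zero_add] at h0
  exact one_ne_zero h0

end Preparations

theorem zeta_nonvanishing_top
    (F : Type) [Field F] [Fintype F] (p r : ℕ) (hp : p.Prime) (hp2 : p ≠ 2)
    (hr : 0 < r) (hcard : Fintype.card F = p ^ r)
    (ψ : AddChar F ℂ) (hψ : ψ ≠ 1)
    (l : ℕ) (hl : 2 ≤ l) (ρ : F) (hρ : ∀ x : F, x ^ 2 ≠ ρ)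
    (V : Type) [AddCommGroup V] [Module ℂ V]
    (π : Representation ℂ (SO2l F l ρ) V)
    (hπirr : IsIrrep π)
    (hπcusp : IsCuspidal F l ρ π)
    (Γ : V →ₗ[ℂ] ℂ) (hΓ : IsWhittaker F l ρ ψ π Γ)
    (v₀ : V) (hv₀ : IsWhitVec F l ρ ψ π Γ v₀)
    (Wτ : Type) [AddCommGroup Wτ] [Module ℂ Wτ]
    (τ : Representation ℂ (GL (Fin (l)) F) Wτ)
    (hτirr : IsIrrep τ)
    (Λ : Wτ →ₗ[ℂ] ℂ) (hΛ : IsGenericGLinv F (l) ψ τ Λ)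
    (v : Wτ) :
    Zeta F l ρ l (Bessel F l ρ π Γ v₀) (fvFun F l τ Λ v) =
        fvFun F l τ Λ v (wllMat F l ρ) 1 ∧
      ∃ v' : Wτ, Zeta F l ρ l (Bessel F l ρ π Γ v₀) (fvFun F l τ Λ v') ≠ 0 := by
  have h2 : (2 : F) ≠ 0 := two_ne_zero_of_card hp hp2 hcard
  have hρ0 : ρ ≠ 0 := fun h => hρ 0 (by rw [h, zero_pow two_ne_zero])
  have hzeta := Zeta_Bessel_fvFun hl hρ0 h2 hψ hΓ hv₀ hΛ
  refine ⟨hzeta v, ?_⟩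
  obtain ⟨x, hx⟩ : ∃ x, Λ x ≠ 0 := by
    by_contra! h
    exact hΛ.1 (LinearMap.ext h)
  refine ⟨τ (glScalar l (Units.mk0 (ρ/2) (div_ne_zero hρ0 h2)))⁻¹ x, ?_⟩
  rw [hzeta, fvFun_wllMat (div_ne_zero hρ0 h2), ← Module.End.mul_apply, ← map_mul,
    mul_inv_cancel, map_one, Module.End.one_apply]
  exact hx

end ConverseSO
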